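/- If n ≥ 1, d₁, d₂ ∈ {0,…,9} with d₁ ≠ d₂ and d₁ > 0, and ℓ₁, ℓ₂ ≥ 1 are integers satisfying P_n = (1/9)(d₁·10^{ℓ₁+ℓ₂} − (d₁ − d₂)·10^{ℓ₂} − d₂), then ℓ₁ + ℓ₂ < 9.15×10^{47} and n < 7.38×10^{48}. -/

import Mathlib

/-- The Padovan sequence: `P 0 = 0`, `P 1 = 1`, `P 2 = 1`, `P (n+3) = P (n+1) + P n`. -/
def padovan : ℕ → ℕ
  | 0 => 0
  | 1 => 1
  | 2 => 1
  | n + 3 => padovan (n + 1) + padovan n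

/-! ### Part 1: a congruence sieve for a nonzero last digit -/

/-- The test made at one value `a` of the Padovan sequence modulo `2222000`. -/
def sieveTest (a : ℕ) : Bool :=
  (List.range 10).all fun e => e == 0 || (9 * a + e) % 2000 != 0 ||
    (List.range 10).all fun d => d == 0 || d == e ||
      (List.range 4).all fun x => (List.range 4).all fun y =>
        (9 * a + e + d * 10 ^ x) % 1111 != (d * 10 ^ y + e * 10 ^ x) % 1111

/-- Run the test along the sequence. -/
def sieveLoop : ℕ → ℕ → ℕ → ℕ → Bool
  | 0, a, b, c => a == 0 && b == 1 && c == 1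
  | k + 1, a, b, c => sieveTest a && sieveLoop k b c ((a + b) % 2222000)

theorem sieveLoop_run : sieveLoop 4200 0 1 1 = true := by decide +kernel

theorem sieveLoop_spec (k : ℕ) : ∀ m, sieveLoop k (padovan m % 2222000)
    (padovan (m + 1) % 2222000) (padovan (m + 2) % 2222000) = true →
    (∀ i < k, sieveTest (padovan (m + i) % 2222000) = true) ∧
      padovan (m + k) % 2222000 = 0 ∧ padovan (m + k + 1) % 2222000 = 1 ∧
      padovan (m + k + 2) % 2222000 = 1 := by
  induction k with
  | zero =>
    intro m h
    simp only [sieveLoop, Bool.and_eq_true, beq_iff_eq] at h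
    refine ⟨by intro i hi; omega, h.1.1, h.1.2, h.2⟩
  | succ k ih =>
    intro m h
    simp only [sieveLoop, Bool.and_eq_true] at h
    have h3 : (padovan m % 2222000 + padovan (m + 1) % 2222000) % 2222000
        = padovan (m + 1 + 2) % 2222000 := by
      have : padovan (m + 1 + 2) = padovan (m + 1) + padovan m := by
        show padovan (m + 3) = _
        rw [padovan]
      rw [this, ← Nat.add_mod, Nat.add_comm]
    rw [h3] at h
    obtain ⟨h1, h2⟩ := ih (m + 1) h.2
    refine ⟨?_, ?_⟩
    · intro i hi
      rcases i with _ | i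
      · exact h.1
      · have := h1 i (by omega)
        rwa [show m + 1 + i = m + (i + 1) by ring] at this
    · rw [show m + (k + 1) = m + 1 + k by ring]
      exact h2

theorem padovan_rec (n : ℕ) : padovan (n + 3) = padovan (n + 1) + padovan n := by
  rw [padovan]

theorem padovan_period (n : ℕ) : padovan (n + 4200) % 2222000 = padovan n % 2222000 := by
  have h := sieveLoop_spec 4200 0 sieveLoop_run
  simp only [Nat.zero_add] at h
  induction n using Nat.strong_induction_on with
  | _ n ih =>
    rcases n with _ | _ | _ | n
    · rw [Nat.zero_add, h.2.1, padovan]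
    · rw [Nat.add_comm, show (4200 + (0 + 1)) = 4200 + 1 by rfl, h.2.2.1, padovan]
    · rw [Nat.add_comm, show (4200 + (0 + 1 + 1)) = 4200 + 2 by rfl, h.2.2.2, padovan]
    · have e1 := ih n (by omega)
      have e2 := ih (n + 1) (by omega)
      rw [show n + 1 + 1 + 1 + 4200 = (n + 4200) + 3 by ring, padovan_rec (n + 4200),
        show n + 1 + 1 + 1 = n + 3 by ring, padovan_rec n, Nat.add_mod,
        show n + 4200 + 1 = n + 1 + 4200 by ring, e1, e2, ← Nat.add_mod]

theorem sieveTest_all (n : ℕ) : sieveTest (padovan n % 2222000) = true := by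
  have h := (sieveLoop_spec 4200 0 sieveLoop_run).1
  have hp : ∀ q r, padovan (r + 4200 * q) % 2222000 = padovan r % 2222000 := by
    intro q
    induction q with
    | zero => intro r; simp
    | succ q ih =>
      intro r
      rw [show r + 4200 * (q + 1) = (r + 4200 * q) + 4200 by ring, padovan_period, ih]
  have := h (n % 4200) (Nat.mod_lt _ (by norm_num))
  rw [Nat.zero_add] at this
  rw [← Nat.mod_add_div n 4200, hp]
  exact this

theorem ten_pow_mod (l : ℕ) : 10 ^ l % 1111 = 10 ^ (l % 4) % 1111 := by
  conv_lhs => rw [← Nat.mod_add_div l 4, pow_add, pow_mul, Nat.mul_mod, Nat.pow_mod (10 ^ 4)]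
  norm_num

theorem sieve_main (n d₁ d₂ L l : ℕ) (hd₁ : d₁ ≤ 9) (hd₂ : d₂ ≤ 9) (hne : d₁ ≠ d₂)
    (hd₁pos : 0 < d₁) (hd₂pos : 0 < d₂) (hl : 4 ≤ l) (hL : l ≤ L)
    (heq : 9 * padovan n + d₂ + d₁ * 10 ^ l = d₁ * 10 ^ L + d₂ * 10 ^ l) : False := by
  have ht := sieveTest_all n
  set a := padovan n % 2222000 with ha
  have h1 : (9 * a + d₂) % 2000 = 0 := by
    obtain ⟨u, hu⟩ : 2000 ∣ 10 ^ l := (show 2000 ∣ 10 ^ 4 by norm_num).trans (pow_dvd_pow _ hl)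
    obtain ⟨v, hv⟩ : 2000 ∣ 10 ^ L :=
      (show 2000 ∣ 10 ^ 4 by norm_num).trans (pow_dvd_pow _ (hl.trans hL))
    rw [hu, hv] at heq
    have e : 9 * padovan n + d₂ + 2000 * (d₁ * u) = 2000 * (d₁ * v) + 2000 * (d₂ * u) := by
      linarith
    omega
  have h2 : (9 * a + d₂ + d₁ * 10 ^ (l % 4)) % 1111
      = (d₁ * 10 ^ (L % 4) + d₂ * 10 ^ (l % 4)) % 1111 := by
    have e1 : 9 * a + d₂ + d₁ * 10 ^ (l % 4) ≡ 9 * padovan n + d₂ + d₁ * 10 ^ l [MOD 1111] := by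
      refine Nat.ModEq.add (Nat.ModEq.add (Nat.ModEq.mul_left _ ?_) rfl) (Nat.ModEq.mul_left _ ?_)
      · show _ % _ = _ % _
        rw [ha, Nat.mod_mod_of_dvd _ (by norm_num)]
      · exact (ten_pow_mod l).symm
    have e2 : d₁ * 10 ^ L + d₂ * 10 ^ l ≡ d₁ * 10 ^ (L % 4) + d₂ * 10 ^ (l % 4) [MOD 1111] :=
      Nat.ModEq.add (Nat.ModEq.mul_left _ (ten_pow_mod L)) (Nat.ModEq.mul_left _ (ten_pow_mod l))
    rw [heq] at e1
    exact e1.trans e2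
  simp only [sieveTest, List.all_eq_true, List.mem_range, Bool.or_eq_true, beq_iff_eq,
    bne_iff_ne] at ht
  rcases ht d₂ (by omega) with (h | h) | h
  · omega
  · exact h h1
  · rcases h d₁ (by omega) with (h | h) | h
    · omega
    · exact hne h
    · exact h (l % 4) (Nat.mod_lt _ (by norm_num)) (L % 4) (Nat.mod_lt _ (by norm_num)) h2



/-! ### Part 2: two-adic valuation -/

/-- The Padovan sequence shifted back by sixteen. -/
def zSeq : ℕ → ℤ
  | 0 => 0
  | 1 => -3
  | 2 => 4
  | n + 3 => zSeq (n + 1) + zSeq n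

theorem zSeq_rec (n : ℕ) : zSeq (n + 3) = zSeq (n + 1) + zSeq n := by
  rw [zSeq]

theorem zSeq_padovan (n : ℕ) : zSeq (n + 16) = padovan n ∧ zSeq (n + 17) = padovan (n + 1) ∧
    zSeq (n + 18) = padovan (n + 2) := by
  induction n with
  | zero => decide
  | succ n ih =>
    refine ⟨by rw [← ih.2.1], by rw [← ih.2.2], ?_⟩
    rw [show n + 1 + 18 = (n + 16) + 3 by ring, zSeq_rec (n + 16), ih.1,
      show n + 16 + 1 = n + 17 by ring, ih.2.1, show n + 1 + 2 = n + 3 by ring, padovan_rec n]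
    push_cast
    ring

/-- The shift operator on integer sequences. -/
def shiftE : Module.End ℤ (ℕ → ℤ) where
  toFun g := fun n => g (n + 1)
  map_add' _ _ := rfl
  map_smul' _ _ := rfl

theorem shiftE_pow (k : ℕ) (g : ℕ → ℤ) (n : ℕ) : (shiftE ^ k) g n = g (n + k) := by
  induction k generalizing g n with
  | zero => simp
  | succ k ih =>
    rw [pow_succ, Module.End.mul_apply, ih]
    show g (n + k + 1) = _
    rw [Nat.add_assoc]

open Polynomial in
theorem padPoly_pow (k u : ℕ) : ∃ G H : ℤ[X], (X : ℤ[X]) ^ (28 * 2 ^ k * u) =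
    1 + 2 ^ (3 + k) * ((u : ℤ[X]) * (58 + 102 * X + 77 * X ^ 2) + 4 * G) + (X ^ 3 - X - 1) * H := by
  have base : ∃ G H : ℤ[X], (X : ℤ[X]) ^ (28 * 2 ^ k) =
      1 + 2 ^ (3 + k) * ((58 + 102 * X + 77 * X ^ 2) + 4 * G) + (X ^ 3 - X - 1) * H := by
    induction k with
    | zero =>
      refine ⟨0, 465+351*X+265*X^2+200*X^3+151*X^4+114*X^5+86*X^6+65*X^7+49*X^8+37*X^9+28*X^10
        +21*X^11+16*X^12+12*X^13+9*X^14+7*X^15+5*X^16+4*X^17+3*X^18+2*X^19+2*X^20+X^21+X^22+X^23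
        +X^25, ?_⟩
      ring
    | succ k ih =>
      obtain ⟨G, H, h⟩ := ih
      refine ⟨G + 2 ^ k * (58 + 102 * X + 77 * X ^ 2 + 4 * G) ^ 2,
        H * (2 * (1 + 2 ^ (3 + k) * ((58 + 102 * X + 77 * X ^ 2) + 4 * G)) + (X ^ 3 - X - 1) * H),
        ?_⟩
      rw [show 28 * 2 ^ (k + 1) = (28 * 2 ^ k) * 2 by ring, pow_mul, h]
      ring
  obtain ⟨G0, H0, h0⟩ := base
  induction u with
  | zero => exact ⟨0, 0, by simp⟩
  | succ u ih =>
    obtain ⟨G, H, h⟩ := ih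
    refine ⟨G + G0 + 2 ^ (k + 1) * ((u : ℤ[X]) * (58 + 102 * X + 77 * X ^ 2) + 4 * G)
        * ((58 + 102 * X + 77 * X ^ 2) + 4 * G0),
      H * (1 + 2 ^ (3 + k) * ((58 + 102 * X + 77 * X ^ 2) + 4 * G0))
       + H0 * (1 + 2 ^ (3 + k) * ((u : ℤ[X]) * (58 + 102 * X + 77 * X ^ 2) + 4 * G))
       + (X ^ 3 - X - 1) * H * H0, ?_⟩
    rw [mul_add, pow_add, h, mul_one, h0]
    push_cast
    ring

open Polynomial in
theorem zSeq_shift (k u n : ℕ) : ∃ g : ℤ, zSeq (n + 28 * 2 ^ k * u) = zSeq n + 2 ^ (3 + k) *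
    (u * (58 * zSeq n + 102 * zSeq (n + 1) + 77 * zSeq (n + 2)) + 4 * g) := by
  obtain ⟨G, H, h⟩ := padPoly_pow k u
  have hf : (aeval shiftE (X ^ 3 - X - 1 : ℤ[X])) zSeq = 0 := by
    funext n
    simp only [map_sub, map_pow, aeval_X, map_one, LinearMap.sub_apply, Pi.sub_apply, shiftE_pow,
      Module.End.one_apply, Pi.zero_apply]
    rw [zSeq_rec n]
    show _ - zSeq (n + 1) - _ = 0
    ring
  have h2 := congrArg (fun p => (aeval shiftE p) zSeq n) h
  rw [mul_comm (X ^ 3 - X - 1 : ℤ[X]) H] at h2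
  refine ⟨(aeval shiftE G) zSeq n, ?_⟩
  have e1 : (aeval shiftE (2 ^ (3 + k) * ((u : ℤ[X]) * (58 + 102 * X + 77 * X ^ 2) + 4 * G)))
      = (2 ^ (3 + k) : ℤ) • ((u : ℤ) • ((58 : ℤ) • (1 : Module.End ℤ (ℕ → ℤ)) +
        (102 : ℤ) • shiftE + (77 : ℤ) • shiftE ^ 2) + (4 : ℤ) • aeval shiftE G) := by
    have : (2 ^ (3 + k) * ((u : ℤ[X]) * (58 + 102 * X + 77 * X ^ 2) + 4 * G))
      = (2 ^ (3 + k) : ℤ) • ((u : ℤ) • ((58 : ℤ) • (1 : ℤ[X]) +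
        (102 : ℤ) • X + (77 : ℤ) • X ^ 2) + (4 : ℤ) • G) := by
      simp only [zsmul_eq_mul]
      push_cast
      ring
    rw [this]
    simp only [map_smul, map_add, map_pow, aeval_X, map_one]
  simp only [map_add, map_one, map_mul, map_pow, aeval_X, shiftE_pow] at h2 e1
  rw [e1] at h2
  simp only [LinearMap.add_apply, Pi.add_apply, Module.End.mul_apply, hf, map_zero, Pi.zero_apply,
    shiftE_pow, LinearMap.smul_apply, Pi.smul_apply, Module.End.one_apply, smul_eq_mul] at h2
  rw [h2]
  simp only [shiftE, LinearMap.coe_mk, AddHom.coe_mk]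
  ring

theorem zSeq_small : ∀ r < 28, (8 : ℤ) ∣ zSeq r → zSeq r = 0 ∧
    ¬ (4 : ℤ) ∣ (58 * zSeq r + 102 * zSeq (r + 1) + 77 * zSeq (r + 2)) ∧ r ≤ 16 := by
  decide +kernel

theorem two_adic (n l : ℕ) (hn : 1 ≤ n) (h : 2 ^ l ∣ padovan n) : 2 ^ l ≤ n + 16 := by
  by_contra hlt
  push Not at hlt
  have hl : 5 ≤ l := by
    by_contra hl
    have : 2 ^ l ≤ 2 ^ 4 := Nat.pow_le_pow_right (by norm_num) (by omega)
    omega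
  have hz : (2 : ℤ) ^ l ∣ zSeq (n + 16) := by
    rw [(zSeq_padovan n).1]; exact_mod_cast h
  set v := n + 16 with hv
  have hvr : v = v % 28 + 28 * (v / 28) := (Nat.mod_add_div v 28).symm
  have h8 : (8 : ℤ) ∣ zSeq (v % 28) := by
    obtain ⟨g, hg⟩ := zSeq_shift 0 (v / 28) (v % 28)
    rw [show v % 28 + 28 * 2 ^ 0 * (v / 28) = v by omega] at hg
    have : (8 : ℤ) ∣ zSeq v := (show (8 : ℤ) ∣ 2 ^ l from
      (show (8 : ℤ) = 2 ^ 3 by norm_num) ▸ pow_dvd_pow 2 (by omega)).trans hz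
    rw [hg] at this
    norm_num at this
    exact this
  obtain ⟨h0, h4, h16⟩ := zSeq_small (v % 28) (Nat.mod_lt _ (by norm_num)) h8
  have ht : v / 28 ≠ 0 := by omega
  obtain ⟨k, u, hu, hku⟩ := Nat.exists_eq_two_pow_mul_odd ht
  obtain ⟨g, hg⟩ := zSeq_shift k u (v % 28)
  rw [show v % 28 + 28 * 2 ^ k * u = v by rw [mul_assoc, ← hku]; omega, h0, zero_add] at hg
  have hlk : l ≤ k + 4 := by
    by_contra hlk
    have h5 : (2 : ℤ) ^ (3 + k) * 4 ∣ zSeq v := by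
      rw [show (2 : ℤ) ^ (3 + k) * 4 = 2 ^ (k + 5) by ring]
      exact (pow_dvd_pow 2 (by omega)).trans hz
    rw [hg] at h5
    have h6 := (mul_dvd_mul_iff_left (by positivity)).1 h5
    have h7 := (dvd_add_left (Dvd.intro _ rfl)).1 h6
    rw [h0] at h4
    refine h4 ?_
    have hc : IsCoprime (4 : ℤ) (u : ℤ) := by
      rw [show (4 : ℤ) = 2 ^ 2 by norm_num]
      apply IsCoprime.pow_left
      have : Nat.Coprime 2 u := hu.coprime_two_left
      exact_mod_cast Nat.isCoprime_iff_coprime.2 this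
    exact hc.dvd_of_dvd_mul_left h7
  have h2 : 2 ^ l ≤ 2 ^ k * 16 := by
    calc 2 ^ l ≤ 2 ^ (k + 4) := Nat.pow_le_pow_right (by norm_num) hlk
      _ = _ := by ring
  have hk : 2 ^ k ≤ v / 28 := by rw [hku]; exact Nat.le_mul_of_pos_right _ hu.pos
  omega


/-! ### Part 3a: approximate Schwarz lemma -/

theorem iteratedDeriv_shift_mul (c a : ℂ) (g : ℂ → ℂ) (hg : Differentiable ℂ g) (i : ℕ) :
    iteratedDeriv (i + 1) (fun z => c + (z - a) * g z) =
      fun z => (z - a) * iteratedDeriv (i + 1) g z + (i + 1) * iteratedDeriv i g z := by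
  have hd : ∀ k, Differentiable ℂ (iteratedDeriv k g) := fun k =>
    (hg.contDiff (n := ⊤)).differentiable_iteratedDeriv k (by exact_mod_cast WithTop.coe_lt_top _)
  induction i with
  | zero =>
    funext z
    rw [zero_add, iteratedDeriv_one, iteratedDeriv_one, iteratedDeriv_zero]
    have h1 : HasDerivAt (fun z => c + (z - a) * g z) (1 * g z + (z - a) * deriv g z) z :=
      (((hasDerivAt_id z).sub_const a).mul (hg z).hasDerivAt).const_add c
    rw [h1.deriv]
    push_cast
    ring
  | succ i ih =>
    rw [iteratedDeriv_succ, ih]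
    funext z
    have e1 : HasDerivAt (iteratedDeriv (i + 1) g) (iteratedDeriv (i + 1 + 1) g z) z := by
      rw [iteratedDeriv_succ (n := i + 1)]
      exact (hd (i + 1) z).hasDerivAt
    have e2 : HasDerivAt (iteratedDeriv i g) (iteratedDeriv (i + 1) g z) z := by
      rw [iteratedDeriv_succ (n := i)]
      exact (hd i z).hasDerivAt
    have h1 := (((hasDerivAt_id z).sub_const a).mul e1).add (e2.const_mul ((i : ℂ) + 1))
    refine h1.deriv.trans ?_
    simp only [id]
    push_cast
    ring

theorem interp_bound (L1 M : ℕ) (D ρ : ℝ) (hD1 : 1 ≤ D) (hD : (L1 : ℝ) ≤ D) (hρ : 5 * D ≤ ρ)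
    (N : ℕ) : ∀ (μ : ℕ → ℕ) (_ : ∀ l, μ l ≤ M) (_ : ∑ l ∈ Finset.range L1, μ l = N)
      (f : ℂ → ℂ) (B δ : ℝ) (_ : Differentiable ℂ f) (_ : 0 ≤ δ)
      (_ : ∀ z, ‖z‖ = ρ → ‖f z‖ ≤ B)
      (_ : ∀ l < L1, ∀ i < μ l, ‖iteratedDeriv i f (l : ℂ)‖ ≤ δ * (i.factorial : ℝ))
      (x : ℝ) (_ : 0 ≤ x) (_ : x ≤ D),
      ‖f (x : ℂ)‖ ≤ B / 4 ^ N + δ * ((M + 1) * (D + 2)) ^ N := by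
  induction N with
  | zero =>
    intro μ hμ hN f B δ hf hδ hB hG x hx0 hxD
    have : ‖f x‖ ≤ B := by
      refine Complex.norm_le_of_forall_mem_frontier_norm_le (U := Metric.ball 0 ρ)
        Metric.isBounded_ball hf.diffContOnCl ?_ ?_
      · intro z hz
        rw [frontier_ball _ (by linarith)] at hz
        exact hB z (by simpa using hz)
      · apply subset_closure
        simp only [Metric.mem_ball, dist_zero_right, Complex.norm_real, Real.norm_eq_abs,
          abs_of_nonneg hx0]
        linarith
    simp only [pow_zero, div_one, mul_one]
    linarith
  | succ N ih =>
    intro μ hμ hN f B δ hf hδ hB hG x hx0 hxD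
    obtain ⟨a, ha, hμa⟩ : ∃ a ∈ Finset.range L1, 0 < μ a := by
      by_contra hcon
      push Not at hcon
      have : ∑ l ∈ Finset.range L1, μ l = 0 :=
        Finset.sum_eq_zero fun l hl => Nat.le_zero.1 (hcon l hl)
      omega
    have haL : a < L1 := Finset.mem_range.1 ha
    have haD : (a : ℝ) + 1 ≤ L1 := by exact_mod_cast haL
    have ha0 : (0 : ℝ) ≤ a := Nat.cast_nonneg a
    set f1 := dslope f (a : ℂ) with hf1
    have hf1d : Differentiable ℂ f1 := by
      have := (Complex.differentiableOn_dslope (s := Set.univ) (c := (a : ℂ)) (f := f)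
        Filter.univ_mem).2 hf.differentiableOn
      exact differentiableOn_univ.1 this
    have hff : f = fun z => f a + (z - a) * f1 z := by
      funext z
      have := sub_smul_dslope f (a : ℂ) z
      rw [smul_eq_mul] at this
      rw [hf1, this]
      ring
    have hfa : ‖f a‖ ≤ δ := by
      have := hG a haL 0 hμa
      simpa using this
    set μ1 : ℕ → ℕ := Function.update μ a (μ a - 1) with hμ1
    have hμ1M : ∀ l, μ1 l ≤ M := by
      intro l
      rw [hμ1]
      by_cases h : l = a
      · subst h
        rw [Function.update_self]
        exact (Nat.sub_le _ _).trans (hμ l)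
      · rw [Function.update_of_ne h]
        exact hμ l
    have hμ1N : ∑ l ∈ Finset.range L1, μ1 l = N := by
      rw [hμ1, Finset.sum_update_of_mem ha]
      have := Finset.add_sum_erase (Finset.range L1) μ ha
      rw [← Finset.erase_eq] 
      omega
    have hM0 : (0 : ℝ) ≤ M := Nat.cast_nonneg M
    have hB1 : ∀ z, ‖z‖ = ρ → ‖f1 z‖ ≤ (B + δ) / (4 * D) := by
      intro z hz
      have h1 : (z - a) * f1 z = f z - f a := by
        conv_rhs => rw [hff]
        simp
      have h2 : 4 * D ≤ ‖z - a‖ := by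
        have := norm_sub_norm_le z (a : ℂ)
        rw [hz, Complex.norm_natCast] at this
        linarith
      rw [le_div_iff₀ (by linarith)]
      calc ‖f1 z‖ * (4 * D) ≤ ‖f1 z‖ * ‖z - a‖ := by gcongr
        _ = ‖(z - a) * f1 z‖ := by rw [norm_mul, mul_comm]
        _ = ‖f z - f a‖ := by rw [h1]
        _ ≤ ‖f z‖ + ‖f a‖ := norm_sub_le _ _
        _ ≤ B + δ := add_le_add (hB z hz) hfa
    have hG1 : ∀ l < L1, ∀ i < μ1 l,
        ‖iteratedDeriv i f1 (l : ℂ)‖ ≤ ((M + 1) * δ) * (i.factorial : ℝ) := by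
      intro l hl i hi
      by_cases hla : l = a
      · subst hla
        rw [hμ1, Function.update_self] at hi
        have h1 := hG l hl (i + 1) (by omega)
        rw [hff, iteratedDeriv_shift_mul _ _ _ hf1d] at h1
        simp only [sub_self, zero_mul, zero_add, norm_mul] at h1
        rw [show ‖(i : ℂ) + 1‖ = (i : ℝ) + 1 by
          rw [show (i : ℂ) + 1 = ((i + 1 : ℕ) : ℂ) by push_cast; ring, Complex.norm_natCast]
          push_cast; ring, Nat.factorial_succ] at h1
        push_cast at h1
        have hp : (0 : ℝ) < (i : ℝ) + 1 := by positivity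
        have h3 : ‖iteratedDeriv i f1 (l : ℂ)‖ ≤ δ * (i.factorial : ℝ) := by
          refine le_of_mul_le_mul_left (h1.trans (le_of_eq ?_)) hp
          ring
        refine h3.trans ?_
        have : 0 ≤ δ * (i.factorial : ℝ) := by positivity
        nlinarith
      · rw [hμ1, Function.update_of_ne hla] at hi
        have hdist : (1 : ℝ) ≤ ‖(l : ℂ) - a‖ := by
          have : ((l : ℂ) - a) = (((l : ℤ) - (a : ℤ) : ℤ) : ℂ) := by push_cast; ring
          rw [this, Complex.norm_intCast]
          have h0 : ((l : ℤ) - (a : ℤ)) ≠ 0 := by omega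
          exact_mod_cast Int.one_le_abs h0
        have key : ∀ j ≤ i, ‖iteratedDeriv j f1 (l : ℂ)‖ ≤ ((j + 2) * δ) * (j.factorial : ℝ) := by
          intro j
          induction j with
          | zero =>
            intro _
            have h1 : ((l : ℂ) - a) * f1 l = f l - f a := by
              conv_rhs => rw [hff]
              simp
            have h2 := hG l hl 0 (by omega)
            simp only [iteratedDeriv_zero, Nat.factorial_zero, Nat.cast_one, mul_one] at h2 ⊢
            calc ‖f1 l‖ = 1 * ‖f1 l‖ := by ring
              _ ≤ ‖(l : ℂ) - a‖ * ‖f1 l‖ := by gcongr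
              _ = ‖f l - f a‖ := by rw [← norm_mul, h1]
              _ ≤ ‖f l‖ + ‖f a‖ := norm_sub_le _ _
              _ ≤ _ := by push_cast; linarith
          | succ j ihj =>
            intro hj
            have h0 := ihj (by omega)
            have h1 := hG l hl (j + 1) (by omega)
            rw [hff, iteratedDeriv_shift_mul _ _ _ hf1d] at h1
            have h2 : ‖((j : ℂ) + 1) * iteratedDeriv j f1 (l : ℂ)‖ ≤
                (j + 1) * (((j + 2) * δ) * (j.factorial : ℝ)) := by
              rw [norm_mul, show ‖(j : ℂ) + 1‖ = (j : ℝ) + 1 by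
                rw [show (j : ℂ) + 1 = ((j + 1 : ℕ) : ℂ) by push_cast; ring, Complex.norm_natCast]
                push_cast; ring]
              gcongr
            calc ‖iteratedDeriv (j + 1) f1 (l : ℂ)‖ = 1 * ‖iteratedDeriv (j + 1) f1 (l : ℂ)‖ := by
                  ring
              _ ≤ ‖(l : ℂ) - a‖ * ‖iteratedDeriv (j + 1) f1 (l : ℂ)‖ := by gcongr
              _ = ‖((l : ℂ) - a) * iteratedDeriv (j + 1) f1 (l : ℂ)‖ := by rw [norm_mul]
              _ ≤ ‖((l : ℂ) - a) * iteratedDeriv (j + 1) f1 (l : ℂ)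
                  + ((j : ℂ) + 1) * iteratedDeriv j f1 (l : ℂ)‖
                  + ‖((j : ℂ) + 1) * iteratedDeriv j f1 (l : ℂ)‖ := by
                  have := norm_sub_le (((l : ℂ) - a) * iteratedDeriv (j + 1) f1 (l : ℂ)
                  + ((j : ℂ) + 1) * iteratedDeriv j f1 (l : ℂ))
                    (((j : ℂ) + 1) * iteratedDeriv j f1 (l : ℂ))
                  rwa [add_sub_cancel_right] at this
              _ ≤ δ * ((j + 1).factorial : ℝ) + (j + 1) * (((j + 2) * δ) * (j.factorial : ℝ)) :=
                  add_le_add h1 h2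
              _ = _ := by
                  rw [Nat.factorial_succ]
                  push_cast
                  ring
        refine (key i le_rfl).trans ?_
        have : (i : ℝ) + 1 ≤ M := by exact_mod_cast (show i + 1 ≤ M from (Nat.succ_le_of_lt hi).trans (hμ l))
        refine mul_le_mul_of_nonneg_right (mul_le_mul_of_nonneg_right ?_ hδ) (by positivity)
        linarith
    have h := ih μ1 hμ1M hμ1N f1 _ _ hf1d (by positivity) hB1 hG1 x hx0 hxD
    have hxa : ‖(x : ℂ) - a‖ ≤ D := by
      rw [show (x : ℂ) - a = ((x - a : ℝ) : ℂ) by push_cast; ring, Complex.norm_real,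
        Real.norm_eq_abs, abs_le]
      constructor <;> linarith
    set Q : ℝ := ((M + 1) * (D + 2)) with hQ
    have hQ1 : 1 ≤ Q := by rw [hQ]; nlinarith
    have hQN : 1 ≤ Q ^ N := one_le_pow₀ hQ1
    calc ‖f x‖ = ‖f a + ((x : ℂ) - a) * f1 x‖ := by conv_lhs => rw [hff]
      _ ≤ ‖f a‖ + ‖((x : ℂ) - a)‖ * ‖f1 x‖ := (norm_add_le _ _).trans (by rw [norm_mul])
      _ ≤ δ + D * ((B + δ) / (4 * D) / 4 ^ N + (M + 1) * δ * Q ^ N) := by gcongr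
      _ = B / 4 ^ (N + 1) + δ * (1 + 1 / 4 ^ (N + 1) + D * (M + 1) * Q ^ N) := by
          field_simp
          ring
      _ ≤ B / 4 ^ (N + 1) + δ * Q ^ (N + 1) := by
          gcongr
          have h4 : (1 : ℝ) / 4 ^ (N + 1) ≤ 1 := by
            rw [div_le_one (by positivity)]
            exact one_le_pow₀ (by norm_num)
          rw [pow_succ Q N]
          have : Q = D * (M + 1) + 2 * (M + 1) := by rw [hQ]; ring
          have h5 : Q ^ N * Q = D * (M + 1) * Q ^ N + 2 * (M + 1) * Q ^ N := by
            conv_lhs => rw [this]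
            rw [← this]; ring
          rw [h5]
          nlinarith


/-! ### Part 3b: extrapolation for exponential sums -/

theorem iteratedDeriv_expSum {ι : Type*} [Fintype ι] (c ω : ι → ℂ) (j : ℕ) :
    iteratedDeriv j (fun z : ℂ => ∑ i, c i * Complex.exp (ω i * z)) =
      fun z => ∑ i, c i * ω i ^ j * Complex.exp (ω i * z) := by
  induction j with
  | zero => simp
  | succ j ih =>
    rw [iteratedDeriv_succ, ih]
    funext z
    have h : HasDerivAt (fun z => ∑ i, c i * ω i ^ j * Complex.exp (ω i * z))
        (∑ i, c i * ω i ^ j * (Complex.exp (ω i * z) * (ω i * 1))) z := by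
      apply HasDerivAt.fun_sum
      intro i _
      exact (((hasDerivAt_id z).const_mul (ω i)).cexp).const_mul _
    rw [h.deriv]
    refine Finset.sum_congr rfl fun i _ => ?_
    ring

theorem extrap {ι : Type*} [Fintype ι] (c X Y ω : ι → ℝ) (a b η W E : ℝ) (L1 M : ℕ) (D : ℝ)
    (hω : ∀ i, |ω i| ≤ W) (hωprime : ∀ i, |X i * a + Y i * b| ≤ W)
    (hη : ∀ i, |ω i - (X i * a + Y i * b)| ≤ η) (hη0 : 0 ≤ η) (hW : 1 ≤ W)
    (hE : ∑ i, |c i| ≤ E)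
    (hv : ∀ u v, u + v < M → ∀ l < L1,
      ∑ i, c i * X i ^ u * Y i ^ v * Real.exp (ω i * (l : ℝ)) = 0)
    (hD : 1 ≤ D) (hL : (L1 : ℝ) ≤ D) (x : ℝ) (hx0 : 0 ≤ x) (hxD : x ≤ D) :
    |∑ i, c i * Real.exp (ω i * x)| ≤ E * Real.exp (5 * D * W) / 4 ^ (M * L1) +
      (E * (M * W ^ M * η) * Real.exp (D * W)) * ((M + 1) * (D + 2)) ^ (M * L1) := by
  set f : ℂ → ℂ := fun z => ∑ i, (c i : ℂ) * Complex.exp ((ω i : ℂ) * z) with hf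
  have hE0 : 0 ≤ E := (Finset.sum_nonneg fun i _ => abs_nonneg _).trans hE
  have hfx : f x = ((∑ i, c i * Real.exp (ω i * x) : ℝ) : ℂ) := by
    simp only [hf]
    push_cast
    rfl
  have hfd : Differentiable ℂ f := by
    rw [hf]
    fun_prop
  have hδ : 0 ≤ E * (M * W ^ M * η) * Real.exp (D * W) := by positivity
  have := interp_bound L1 M D (5 * D) hD hL le_rfl (M * L1) (fun _ => M) (fun _ => le_rfl)
    (by simp [mul_comm]) f (E * Real.exp (5 * D * W)) _ hfd hδ ?_ ?_ x hx0 hxD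
  · rw [hfx, Complex.norm_real, Real.norm_eq_abs] at this
    exact this
  · intro z hz
    calc ‖f z‖ ≤ ∑ i, ‖(c i : ℂ) * Complex.exp ((ω i : ℂ) * z)‖ := norm_sum_le _ _
      _ ≤ ∑ i, |c i| * Real.exp (5 * D * W) := by
          refine Finset.sum_le_sum fun i _ => ?_
          rw [norm_mul, Complex.norm_real, Real.norm_eq_abs]
          gcongr
          refine (Complex.norm_exp_le_exp_norm _).trans ?_
          rw [Real.exp_le_exp, norm_mul, hz, Complex.norm_real, Real.norm_eq_abs, mul_comm]
          exact mul_le_mul_of_nonneg_left (hω i) (by linarith)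
      _ = (∑ i, |c i|) * Real.exp (5 * D * W) := by rw [Finset.sum_mul]
      _ ≤ _ := by gcongr
  · intro l hl j hj
    have hj' : j < M := hj
    rw [hf, iteratedDeriv_expSum]
    have e1 : (∑ i, (c i : ℂ) * (ω i : ℂ) ^ j * Complex.exp ((ω i : ℂ) * (l : ℂ)))
      = ((∑ i, c i * ω i ^ j * Real.exp (ω i * l) : ℝ) : ℂ) := by
      push_cast
      rfl
    have e2 : ∑ i, c i * (X i * a + Y i * b) ^ j * Real.exp (ω i * l) = 0 := by
      have : ∀ i, c i * (X i * a + Y i * b) ^ j * Real.exp (ω i * l) =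
          ∑ u ∈ Finset.range (j + 1), (a ^ u * b ^ (j - u) * (j.choose u : ℝ)) *
            (c i * X i ^ u * Y i ^ (j - u) * Real.exp (ω i * l)) := by
        intro i
        rw [add_pow, Finset.mul_sum, Finset.sum_mul]
        refine Finset.sum_congr rfl fun u _ => ?_
        rw [mul_pow, mul_pow]
        ring
      simp only [this]
      rw [Finset.sum_comm]
      refine Finset.sum_eq_zero fun u hu => ?_
      rw [← Finset.mul_sum, hv u (j - u) ?_ l hl, mul_zero]
      have := Finset.mem_range.1 hu
      omega
    simp only
    rw [e1, Complex.norm_real, Real.norm_eq_abs]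
    have e3 : ∑ i, c i * ω i ^ j * Real.exp (ω i * l) =
        ∑ i, c i * (ω i ^ j - (X i * a + Y i * b) ^ j) * Real.exp (ω i * l) := by
      rw [← sub_zero (∑ i, c i * ω i ^ j * Real.exp (ω i * l)), ← e2, ← Finset.sum_sub_distrib]
      refine Finset.sum_congr rfl fun i _ => ?_
      ring
    rw [e3]
    have hf1 : (1 : ℝ) ≤ (j.factorial : ℝ) := by exact_mod_cast Nat.factorial_pos j
    have hlD : (l : ℝ) ≤ D := le_trans (by exact_mod_cast hl.le) hL
    calc |∑ i, c i * (ω i ^ j - (X i * a + Y i * b) ^ j) * Real.exp (ω i * l)|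
        ≤ ∑ i, |c i * (ω i ^ j - (X i * a + Y i * b) ^ j) * Real.exp (ω i * l)| :=
          Finset.abs_sum_le_sum_abs _ _
      _ ≤ ∑ i, |c i| * ((M * W ^ M * η) * Real.exp (D * W)) := by
          refine Finset.sum_le_sum fun i _ => ?_
          rw [abs_mul, abs_mul, Real.abs_exp, mul_assoc]
          have h1 : |ω i ^ j - (X i * a + Y i * b) ^ j| ≤ M * W ^ M * η := by
            refine (abs_pow_sub_pow_le _ _ _).trans ?_
            have hmax : max |ω i| |X i * a + Y i * b| ≤ W := max_le (hω i) (hωprime i)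
            have hmax0 : 0 ≤ max |ω i| |X i * a + Y i * b| := le_max_of_le_left (abs_nonneg _)
            calc |ω i - (X i * a + Y i * b)| * j * max |ω i| |X i * a + Y i * b| ^ (j - 1)
                ≤ η * M * W ^ (j - 1) := by
                  have := hη i
                  gcongr
              _ ≤ η * M * W ^ M := by
                  gcongr
                  omega
              _ = _ := by ring
          have h2 : ω i * l ≤ |ω i| * l := by
            gcongr
            exact le_abs_self _
          have h3 : |ω i| * l ≤ W * D := by
            have := hω i
            gcongr
          have h4 : Real.exp (ω i * l) ≤ Real.exp (D * W) := by
            rw [Real.exp_le_exp]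
            linarith
          gcongr
      _ = (∑ i, |c i|) * ((M * W ^ M * η) * Real.exp (D * W)) := by rw [Finset.sum_mul]
      _ ≤ E * ((M * W ^ M * η) * Real.exp (D * W)) := by gcongr
      _ = (E * (M * W ^ M * η) * Real.exp (D * W)) * 1 := by ring
      _ ≤ _ := by gcongr


/-! ### Part 3c: arithmetic in the cubic ring -/

/-- Evaluation of an integer triple at `x`. -/
def evT (x : ℝ) (v : ℤ × ℤ × ℤ) : ℝ := v.1 + v.2.1 * x + v.2.2 * x ^ 2

/-- The size of a triple. -/
def szT (v : ℤ × ℤ × ℤ) : ℤ := |v.1| + |v.2.1| + |v.2.2|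

/-- The norm form. -/
def nmT (v : ℤ × ℤ × ℤ) : ℤ := v.1 ^ 3 + v.2.1 ^ 3 + v.2.2 ^ 3 + 2 * v.1 ^ 2 * v.2.2
  + v.1 * v.2.2 ^ 2 - v.1 * v.2.1 ^ 2 - 3 * v.1 * v.2.1 * v.2.2 - v.2.1 * v.2.2 ^ 2

/-- Multiplication by the root. -/
def tA (v : ℤ × ℤ × ℤ) : ℤ × ℤ × ℤ := (v.2.2, v.1 + v.2.2, v.2.1)

/-- Multiplication by `3 x ^ 2 - 1`. -/
def tT (v : ℤ × ℤ × ℤ) : ℤ × ℤ × ℤ :=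
  (3 * v.2.1 - v.1, 2 * v.2.1 + 3 * v.2.2, 3 * v.1 + 2 * v.2.2)

theorem nmT_tA (v : ℤ × ℤ × ℤ) : nmT (tA v) = nmT v := by
  simp only [nmT, tA]; ring

theorem nmT_tT (v : ℤ × ℤ × ℤ) : nmT (tT v) = 23 * nmT v := by
  simp only [nmT, tT]; ring

theorem nmT_smul (k : ℤ) (v : ℤ × ℤ × ℤ) : nmT (k • v) = k ^ 3 * nmT v := by
  simp only [nmT, Prod.smul_fst, Prod.smul_snd, smul_eq_mul]; ring

theorem szT_nonneg (v : ℤ × ℤ × ℤ) : 0 ≤ szT v := by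
  unfold szT; positivity

theorem szT_tA (v : ℤ × ℤ × ℤ) : szT (tA v) ≤ 2 * szT v := by
  simp only [szT, tA]
  have := abs_add_le v.1 v.2.2
  have h1 := abs_nonneg v.1
  have h2 := abs_nonneg v.2.1
  have h3 := abs_nonneg v.2.2
  linarith

theorem szT_tT (v : ℤ × ℤ × ℤ) : szT (tT v) ≤ 5 * szT v := by
  simp only [szT, tT]
  have a1 := abs_sub (3 * v.2.1) v.1
  have a2 := abs_add_le (2 * v.2.1) (3 * v.2.2)
  have a3 := abs_add_le (3 * v.1) (2 * v.2.2)
  simp only [abs_mul, Nat.abs_ofNat] at a1 a2 a3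
  have h1 := abs_nonneg v.1
  have h2 := abs_nonneg v.2.1
  have h3 := abs_nonneg v.2.2
  linarith

theorem szT_smul (k : ℤ) (v : ℤ × ℤ × ℤ) : szT (k • v) = |k| * szT v := by
  simp only [szT, Prod.smul_fst, Prod.smul_snd, smul_eq_mul, abs_mul]; ring

theorem evT_tA (x : ℝ) (hx : x ^ 3 = x + 1) (v : ℤ × ℤ × ℤ) : evT x (tA v) = x * evT x v := by
  simp only [evT, tA]
  push_cast
  linear_combination (-(v.2.2 : ℝ)) * hx

theorem evT_tT (x : ℝ) (hx : x ^ 3 = x + 1) (v : ℤ × ℤ × ℤ) :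
    evT x (tT v) = (3 * x ^ 2 - 1) * evT x v := by
  simp only [evT, tT]
  push_cast
  linear_combination (-(3 * v.2.1 : ℝ) - 3 * v.2.2 * x) * hx

theorem evT_smul (x : ℝ) (k : ℤ) (v : ℤ × ℤ × ℤ) : evT x (k • v) = k * evT x v := by
  simp only [evT, Prod.smul_fst, Prod.smul_snd, smul_eq_mul]
  push_cast
  ring

theorem nmT_two : ∀ a b c : ZMod 2, a ^ 3 + b ^ 3 + c ^ 3 + 2 * a ^ 2 * c
  + a * c ^ 2 - a * b ^ 2 - 3 * a * b * c - b * c ^ 2 = 0 → a = 0 ∧ b = 0 ∧ c = 0 := by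
  decide

theorem nmT_eq_zero_aux (m : ℕ) : ∀ v : ℤ × ℤ × ℤ, szT v ≤ m → nmT v = 0 → v = 0 := by
  induction m using Nat.strong_induction_on with
  | _ m ih =>
    intro v hs hv
    have h2 : ((nmT v : ℤ) : ZMod 2) = 0 := by rw [hv]; simp
    unfold nmT at h2
    push_cast at h2
    obtain ⟨h1, h2, h3⟩ := nmT_two _ _ _ h2
    rw [ZMod.intCast_zmod_eq_zero_iff_dvd] at h1 h2 h3
    obtain ⟨a, ha⟩ := h1
    obtain ⟨b, hb⟩ := h2
    obtain ⟨c, hc⟩ := h3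
    have hv2 : v = (2 : ℤ) • ((a, b, c) : ℤ × ℤ × ℤ) := by
      ext
      · simpa using ha
      · simpa using hb
      · simpa using hc
    rw [hv2, nmT_smul] at hv
    have hn : nmT (a, b, c) = 0 := by
      rcases mul_eq_zero.1 hv with h | h
      · norm_num at h
      · exact h
    rw [hv2, szT_smul] at hs
    norm_num at hs
    have h0 := szT_nonneg (a, b, c)
    by_cases hz : szT (a, b, c) = 0
    · simp only [szT] at hz
      have h1 := abs_nonneg a
      have h2 := abs_nonneg b
      have h3 := abs_nonneg c
      have e1 : a = 0 := abs_eq_zero.1 (by linarith)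
      have e2 : b = 0 := abs_eq_zero.1 (by linarith)
      have e3 : c = 0 := abs_eq_zero.1 (by linarith)
      rw [hv2, e1, e2, e3]
      simp
    · have := ih (szT (a, b, c)).toNat (by omega) (a, b, c) (by omega) hn
      rw [hv2, this, smul_zero]

theorem nmT_eq_zero {v : ℤ × ℤ × ℤ} (h : nmT v = 0) : v = 0 :=
  nmT_eq_zero_aux (szT v).toNat v (Int.self_le_toNat _) h

theorem liouvilleT (x : ℝ) (hx : x ^ 3 = x + 1) (hx0 : 0 < x) (hx2 : x < 2) (v : ℤ × ℤ × ℤ)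
    (hv : v ≠ 0) : 1 ≤ |evT x v| * (16 * (szT v : ℝ) ^ 2) := by
  have hn : nmT v ≠ 0 := fun h => hv (nmT_eq_zero h)
  have h1 : (1 : ℝ) ≤ |(nmT v : ℝ)| := by exact_mod_cast Int.one_le_abs hn
  obtain ⟨a, b, c⟩ := v
  set q : ℝ := ((a + c) ^ 2 - b * (b + c)) + (-(b * (a + c) - c * (b + c))) * x
    + (b ^ 2 - c * (a + c)) * x ^ 2 with hq
  have h2 : (nmT (a, b, c) : ℝ) = evT x (a, b, c) * q := by
    rw [hq]
    simp only [nmT, evT]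
    push_cast
    linear_combination (-(b : ℝ) * (b ^ 2 - c * (a + c)) - c * (-(b * (a + c) - c * (b + c)))
      - c * (b ^ 2 - c * (a + c)) * x) * hx
  rw [h2, abs_mul] at h1
  refine h1.trans ?_
  gcongr
  simp only [szT]
  push_cast
  set A := |(a : ℝ)|
  set B := |(b : ℝ)|
  set C := |(c : ℝ)|
  have hA : 0 ≤ A := abs_nonneg _
  have hB : 0 ≤ B := abs_nonneg _
  have hC : 0 ≤ C := abs_nonneg _
  have hab : |(a : ℝ) + c| ≤ A + C := abs_add_le _ _
  have hbc : |(b : ℝ) + c| ≤ B + C := abs_add_le _ _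
  have q0 : |((a : ℝ) + c) ^ 2 - b * (b + c)| ≤ (A + C) ^ 2 + B * (B + C) := by
    refine (abs_sub _ _).trans ?_
    rw [abs_pow, abs_mul]
    gcongr
  have q1 : |(-((b : ℝ) * (a + c) - c * (b + c)))| ≤ B * (A + C) + C * (B + C) := by
    rw [abs_neg]
    refine (abs_sub _ _).trans ?_
    rw [abs_mul, abs_mul]
    gcongr
  have q2 : |((b : ℝ) ^ 2 - c * (a + c))| ≤ B ^ 2 + C * (A + C) := by
    refine (abs_sub _ _).trans ?_
    rw [abs_pow, abs_mul]
    gcongr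
  calc |q| ≤ ((A + C) ^ 2 + B * (B + C)) + (B * (A + C) + C * (B + C)) * 2
        + (B ^ 2 + C * (A + C)) * 2 ^ 2 := by
        rw [hq]
        refine (abs_add_le _ _).trans (add_le_add ((abs_add_le _ _).trans (add_le_add q0 ?_)) ?_)
        · rw [abs_mul, abs_of_pos hx0]
          gcongr
        · rw [abs_mul, abs_of_pos (by positivity : 0 < x ^ 2)]
          gcongr
    _ ≤ 16 * (A + B + C) ^ 2 := by
        have e1 := mul_nonneg hA hB
        have e2 := mul_nonneg hA hC
        have e3 := mul_nonneg hB hC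
        nlinarith [sq_nonneg A, sq_nonneg B, sq_nonneg C]

/-- The coordinate triple of `9 ^ (R * l) * w ^ l`. -/
def wv (d R r s t l : ℕ) : ℤ × ℤ × ℤ :=
  ((10 ^ (t * l) * d ^ (s * l) * 9 ^ ((R - s) * l) : ℕ) : ℤ) •
    (tT^[s * l] (tA^[r * l] ((1, 0, 0) : ℤ × ℤ × ℤ)))

theorem evT_tA_iter (x : ℝ) (hx : x ^ 3 = x + 1) (k : ℕ) (v : ℤ × ℤ × ℤ) :
    evT x (tA^[k] v) = x ^ k * evT x v := by
  induction k generalizing v with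
  | zero => simp
  | succ k ih => rw [Function.iterate_succ_apply, ih, evT_tA x hx]; ring

theorem evT_tT_iter (x : ℝ) (hx : x ^ 3 = x + 1) (k : ℕ) (v : ℤ × ℤ × ℤ) :
    evT x (tT^[k] v) = (3 * x ^ 2 - 1) ^ k * evT x v := by
  induction k generalizing v with
  | zero => simp
  | succ k ih => rw [Function.iterate_succ_apply, ih, evT_tT x hx]; ring

theorem szT_tA_iter (k : ℕ) (v : ℤ × ℤ × ℤ) : szT (tA^[k] v) ≤ 2 ^ k * szT v := by
  induction k generalizing v with
  | zero => simp
  | succ k ih =>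
    rw [Function.iterate_succ_apply]
    refine (ih _).trans ?_
    rw [pow_succ, mul_assoc]
    have := szT_tA v
    gcongr

theorem szT_tT_iter (k : ℕ) (v : ℤ × ℤ × ℤ) : szT (tT^[k] v) ≤ 5 ^ k * szT v := by
  induction k generalizing v with
  | zero => simp
  | succ k ih =>
    rw [Function.iterate_succ_apply]
    refine (ih _).trans ?_
    rw [pow_succ, mul_assoc]
    have := szT_tT v
    gcongr

theorem nmT_tA_iter (k : ℕ) (v : ℤ × ℤ × ℤ) : nmT (tA^[k] v) = nmT v := by
  induction k generalizing v with
  | zero => simp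
  | succ k ih => rw [Function.iterate_succ_apply, ih, nmT_tA]

theorem nmT_tT_iter (k : ℕ) (v : ℤ × ℤ × ℤ) : nmT (tT^[k] v) = 23 ^ k * nmT v := by
  induction k generalizing v with
  | zero => simp
  | succ k ih => rw [Function.iterate_succ_apply, ih, nmT_tT]; ring

theorem evT_wv (x : ℝ) (hx : x ^ 3 = x + 1) (d R r s t l : ℕ) (hs : s ≤ R) :
    evT x (wv d R r s t l) =
      9 ^ (R * l) * (x ^ r * 10 ^ t * ((d : ℝ) * (3 * x ^ 2 - 1) / 9) ^ s) ^ l := by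
  have h1 : evT x (1, 0, 0) = 1 := by simp [evT]
  rw [wv, evT_smul, evT_tT_iter x hx, evT_tA_iter x hx, h1]
  push_cast
  rw [show R * l = (R - s) * l + s * l by rw [← Nat.add_mul]; congr 1; omega]
  rw [div_pow, mul_pow, mul_pow, div_pow, mul_pow, mul_pow]
  simp only [← pow_mul, pow_add]
  field_simp

theorem szT_wv (d R r s t l : ℕ) (hd : d ≤ 9) (hs : s ≤ R) (hr : r ≤ R) (ht : t ≤ R) :
    szT (wv d R r s t l) ≤ 2 ^ (10 * R * l) := by
  have h1 : szT (1, 0, 0) = 1 := by simp [szT]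
  rw [wv, szT_smul, Nat.abs_cast]
  have h2 : szT (tT^[s * l] (tA^[r * l] ((1, 0, 0) : ℤ × ℤ × ℤ))) ≤ 5 ^ (s * l) * 2 ^ (r * l) := by
    refine (szT_tT_iter _ _).trans ?_
    gcongr
    refine (szT_tA_iter _ _).trans ?_
    rw [h1, mul_one]
  calc ((10 ^ (t * l) * d ^ (s * l) * 9 ^ ((R - s) * l) : ℕ) : ℤ) *
        szT (tT^[s * l] (tA^[r * l] ((1, 0, 0) : ℤ × ℤ × ℤ)))
      ≤ (10 ^ (t * l) * 9 ^ (s * l) * 9 ^ ((R - s) * l)) * (5 ^ (s * l) * 2 ^ (r * l)) := by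
        push_cast
        have : (d : ℤ) ≤ 9 := by exact_mod_cast hd
        have := szT_nonneg (tT^[s * l] (tA^[r * l] ((1, 0, 0) : ℤ × ℤ × ℤ)))
        gcongr
    _ = 10 ^ (t * l) * 9 ^ (R * l) * (5 ^ (s * l) * 2 ^ (r * l)) := by
        rw [show R * l = s * l + (R - s) * l by rw [← Nat.add_mul]; congr 1; omega, pow_add]
        ring
    _ ≤ 10 ^ (R * l) * 9 ^ (R * l) * (5 ^ (R * l) * 2 ^ (R * l)) := by
        gcongr <;> norm_num
    _ = 900 ^ (R * l) := by rw [← mul_pow, ← mul_pow, ← mul_pow]; norm_num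
    _ ≤ (2 ^ 10) ^ (R * l) := by gcongr; norm_num
    _ = _ := by rw [← pow_mul, mul_assoc]

theorem evT_inj (x : ℝ) (hx : x ^ 3 = x + 1) (hx0 : 0 < x) (hx2 : x < 2) {v v' : ℤ × ℤ × ℤ}
    (h : evT x v = evT x v') : v = v' := by
  by_contra hne
  have h1 := liouvilleT x hx hx0 hx2 (v - v') (sub_ne_zero.2 hne)
  have h2 : evT x (v - v') = evT x v - evT x v' := by
    simp only [evT, Prod.fst_sub, Prod.snd_sub]
    push_cast
    ring
  rw [h2, h, sub_self, abs_zero, zero_mul] at h1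
  norm_num at h1

theorem w_inj (x : ℝ) (hx : x ^ 3 = x + 1) (hx1 : 1 < x) (hx2 : x < 2) (d R : ℕ) (hd0 : 0 < d)
    (hd : d ≤ 9) (r s t r' s' t' : ℕ) (hs : s ≤ R) (hs' : s' ≤ R)
    (h : x ^ r * 10 ^ t * ((d : ℝ) * (3 * x ^ 2 - 1) / 9) ^ s =
      x ^ r' * 10 ^ t' * ((d : ℝ) * (3 * x ^ 2 - 1) / 9) ^ s') : r = r' ∧ s = s' ∧ t = t' := by
  have hT : 0 < 3 * x ^ 2 - 1 := by nlinarith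
  have hdR : (0 : ℝ) < d := by exact_mod_cast hd0
  have h1 : evT x (wv d R r s t 1) = evT x (wv d R r' s' t' 1) := by
    rw [evT_wv x hx _ _ _ _ _ _ hs, evT_wv x hx _ _ _ _ _ _ hs', h]
  have h2 := congrArg nmT (evT_inj x hx (by linarith) hx2 h1)
  have hN : ∀ r s t, nmT (wv d R r s t 1) = (((10 ^ t * d ^ s * 9 ^ (R - s)) ^ 3 * 23 ^ s : ℕ) : ℤ) := by
    intro r s t
    have h1 : nmT (1, 0, 0) = 1 := by simp [nmT]
    rw [wv, nmT_smul, nmT_tT_iter, nmT_tA_iter, h1]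
    push_cast
    simp
  rw [hN, hN] at h2
  have h3 : (10 ^ t * d ^ s * 9 ^ (R - s)) ^ 3 * 23 ^ s
      = (10 ^ t' * d ^ s' * 9 ^ (R - s')) ^ 3 * 23 ^ s' := by exact_mod_cast h2
  have hval : ∀ s t, padicValNat 23 ((10 ^ t * d ^ s * 9 ^ (R - s)) ^ 3 * 23 ^ s) = s := by
    intro s t
    have : Fact (Nat.Prime 23) := ⟨by norm_num⟩
    have hnd : ¬ 23 ∣ (10 ^ t * d ^ s * 9 ^ (R - s)) ^ 3 := by
      intro hdv
      have hp : Nat.Prime 23 := by norm_num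
      have a1 := hp.dvd_of_dvd_pow hdv
      rcases hp.dvd_mul.1 a1 with a2 | a2
      · rcases hp.dvd_mul.1 a2 with a3 | a3
        · have := hp.dvd_of_dvd_pow a3
          omega
        · have := Nat.le_of_dvd hd0 (hp.dvd_of_dvd_pow a3)
          omega
      · have := hp.dvd_of_dvd_pow a2
        omega
    rw [padicValNat.mul (by positivity) (by positivity), padicValNat.eq_zero_of_not_dvd hnd,
      padicValNat.prime_pow, zero_add]
  have hss : s = s' := by rw [← hval s t, h3, hval]
  subst hss
  have htt : t = t' := by
    have h4 := Nat.eq_of_mul_eq_mul_right (by positivity) h3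
    have h5 := Nat.pow_left_injective (by norm_num : 3 ≠ 0) h4
    have h6 := Nat.eq_of_mul_eq_mul_right (by positivity) h5
    have h7 := Nat.eq_of_mul_eq_mul_right (by positivity) h6
    exact Nat.pow_right_injective (by norm_num) h7
  subst htt
  refine ⟨?_, rfl, rfl⟩
  have h4 : x ^ r = x ^ r' := by
    have hp : (0 : ℝ) < 10 ^ t * ((d : ℝ) * (3 * x ^ 2 - 1) / 9) ^ s := by positivity
    rw [mul_assoc, mul_assoc] at h
    exact mul_right_cancel₀ hp.ne' h
  exact pow_right_injective₀ (by linarith) (by linarith) h4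


/-! ### Part 3d: the Siegel lemma and one extrapolation step -/

theorem siegelInt {α β : Type*} [Fintype α] [Fintype β] (A : α → β → ℤ) (Amax : ℝ)
    (h1 : 1 ≤ Amax) (hA : ∀ i j, |(A i j : ℝ)| ≤ Amax)
    (hcard : 2 * Fintype.card α ≤ Fintype.card β) (hm : 0 < Fintype.card α) :
    ∃ p : β → ℤ, p ≠ 0 ∧ (∀ i, ∑ j, A i j * p j = 0) ∧
      ∀ j, |(p j : ℝ)| ≤ Fintype.card β * Amax := by
  let _ := @Matrix.seminormedAddCommGroup α β ℤ _ _ _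
  obtain ⟨p, hp0, hp, hb⟩ := Int.Matrix.exists_ne_zero_int_vec_norm_le (Matrix.of A)
    (by omega) hm
  refine ⟨p, hp0, fun i => congrFun hp i, fun j => ?_⟩
  have hnA : ‖Matrix.of A‖ ≤ Amax := by
    rw [Matrix.norm_le_iff (by linarith)]
    intro i j
    rw [Matrix.of_apply, Int.norm_eq_abs]
    exact hA i j
  have hc : (1 : ℝ) ≤ Fintype.card β := by
    have : 1 ≤ Fintype.card β := by omega
    exact_mod_cast this
  have hpj : |(p j : ℝ)| ≤ ‖p‖ := by
    rw [← Int.norm_eq_abs]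
    exact norm_le_pi_norm p j
  refine hpj.trans (hb.trans ?_)
  have hbase : (1 : ℝ) ≤ Fintype.card β * max 1 ‖Matrix.of A‖ :=
    one_le_mul_of_one_le_of_one_le hc (le_max_left _ _)
  have hc2 : 2 * (Fintype.card α : ℝ) ≤ Fintype.card β := by exact_mod_cast hcard
  have hm' : (0 : ℝ) < Fintype.card α := by exact_mod_cast hm
  calc _ ≤ ((Fintype.card β : ℝ) * max 1 ‖Matrix.of A‖) ^ (1 : ℝ) := by
        apply Real.rpow_le_rpow_of_exponent_le hbase
        rw [div_le_one (by linarith)]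
        linarith
    _ = (Fintype.card β : ℝ) * max 1 ‖Matrix.of A‖ := Real.rpow_one _
    _ ≤ _ := by
        gcongr
        exact max_le h1 hnA

theorem evT_sum {ι : Type*} (S : Finset ι) (x : ℝ) (v : ι → ℤ × ℤ × ℤ) :
    evT x (∑ i ∈ S, v i) = ∑ i ∈ S, evT x (v i) := by
  classical
  induction S using Finset.induction_on with
  | empty => simp [evT]
  | insert a S ha ih =>
    rw [Finset.sum_insert ha, Finset.sum_insert ha, ← ih]
    simp only [evT, Prod.fst_add, Prod.snd_add]
    push_cast
    ring

theorem szT_sum {ι : Type*} (S : Finset ι) (v : ι → ℤ × ℤ × ℤ) :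
    szT (∑ i ∈ S, v i) ≤ ∑ i ∈ S, szT (v i) := by
  classical
  induction S using Finset.induction_on with
  | empty => simp [szT]
  | insert a S ha ih =>
    rw [Finset.sum_insert ha, Finset.sum_insert ha]
    refine le_trans ?_ (add_le_add_right ih _)
    simp only [szT, Prod.fst_add, Prod.snd_add]
    have h1 := abs_add_le (v a).1 (∑ i ∈ S, v i).1
    have h2 := abs_add_le (v a).2.1 (∑ i ∈ S, v i).2.1
    have h3 := abs_add_le (v a).2.2 (∑ i ∈ S, v i).2.2
    linarith

/-- The numbers to which the exponential sums are attached. -/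
noncomputable def wR (x : ℝ) (d r s t : ℕ) : ℝ :=
  x ^ r * 10 ^ t * ((d : ℝ) * (3 * x ^ 2 - 1) / 9) ^ s

theorem log_ten_lt : Real.log 10 < 2.32 := by
  have h2 := Real.log_two_lt_d9
  have h5 : 3 * Real.log 5 < 7 * Real.log 2 := by
    have : Real.log ((5 : ℝ) ^ 3) < Real.log ((2 : ℝ) ^ 7) :=
      Real.log_lt_log (by norm_num) (by norm_num)
    rw [Real.log_pow, Real.log_pow] at this
    exact_mod_cast this
  have : Real.log 10 = Real.log 2 + Real.log 5 := by
    rw [← Real.log_mul (by norm_num) (by norm_num)]; norm_num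
  linarith

theorem log_theta (x : ℝ) (hx1 : 1 < x) (hx2 : x < 1.33) (d : ℕ) (hd0 : 0 < d) (hd : d ≤ 9) :
    0 < (d : ℝ) * (3 * x ^ 2 - 1) / 9 ∧ |Real.log ((d : ℝ) * (3 * x ^ 2 - 1) / 9)| ≤ 2.08 := by
  have hd1 : (1 : ℝ) ≤ d := by exact_mod_cast hd0
  have hd9 : (d : ℝ) ≤ 9 := by exact_mod_cast hd
  have hT1 : 2 < 3 * x ^ 2 - 1 := by nlinarith
  have hT2 : 3 * x ^ 2 - 1 < 8 := by nlinarith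
  have hp : 0 < (d : ℝ) * (3 * x ^ 2 - 1) / 9 := by positivity
  refine ⟨hp, ?_⟩
  have h2 := Real.log_two_lt_d9
  rw [abs_le]
  constructor
  · have : Real.log ((2 : ℝ) ^ 3)⁻¹ ≤ Real.log ((d : ℝ) * (3 * x ^ 2 - 1) / 9) := by
      apply Real.log_le_log (by positivity)
      rw [le_div_iff₀ (by norm_num)]
      nlinarith
    rw [Real.log_inv, Real.log_pow] at this
    push_cast at this
    linarith
  · have : Real.log ((d : ℝ) * (3 * x ^ 2 - 1) / 9) ≤ Real.log ((2 : ℝ) ^ 3) := by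
      apply Real.log_le_log hp
      rw [div_le_iff₀ (by norm_num)]
      nlinarith
    rw [Real.log_pow] at this
    push_cast at this
    linarith

theorem log_wR (x : ℝ) (hx1 : 1 < x) (hx2 : x < 1.33) (d r s t : ℕ) (hd0 : 0 < d) (hd : d ≤ 9) :
    0 < wR x d r s t ∧ Real.log (wR x d r s t) = r * Real.log x + t * Real.log 10
      + s * Real.log ((d : ℝ) * (3 * x ^ 2 - 1) / 9) := by
  have hp := (log_theta x hx1 hx2 d hd0 hd).1
  have hx0 : 0 < x := by linarith
  refine ⟨by unfold wR; positivity, ?_⟩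
  unfold wR
  rw [Real.log_mul (by positivity) (by positivity), Real.log_mul (by positivity) (by positivity),
    Real.log_pow, Real.log_pow, Real.log_pow]

theorem exp_five_mul_le (k : ℕ) : Real.exp (5 * (k : ℝ)) ≤ 2 ^ (8 * k) := by
  rw [mul_comm, Real.exp_nat_mul, pow_mul]
  gcongr
  have h := Real.exp_one_lt_d9
  have : Real.exp 5 = Real.exp 1 ^ 5 := by rw [← Real.exp_nat_mul]; norm_num
  rw [this]
  calc Real.exp 1 ^ 5 ≤ (2.75 : ℝ) ^ 5 := by gcongr; linarith
    _ ≤ 2 ^ 8 := by norm_num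

theorem baker_step {ι : Type*} [Fintype ι] (x : ℝ) (hx : x ^ 3 = x + 1) (hx1 : 1 < x)
    (hx2 : x < 1.33) (d : ℕ) (hd0 : 0 < d) (hd : d ≤ 9) (m L R b H M L1 L2 : ℕ)
    (r s t : ι → ℕ) (hr : ∀ i, r i ≤ R) (hs : ∀ i, s i ≤ R) (ht : ∀ i, t i ≤ R)
    (c : ι → ℤ) (hc : ∑ i, |(c i : ℝ)| ≤ 2 ^ H) (Λ : ℝ)
    (hΛdef : Λ = m * Real.log x - L * Real.log 10 - Real.log ((d : ℝ) * (3 * x ^ 2 - 1) / 9))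
    (hR : 1 ≤ R) (hL1 : 1 ≤ L1) (hL12 : L1 ≤ L2)
    (h5R : (5 * R : ℝ) ≤ 2 ^ b) (hMR : (M * R : ℝ) ≤ 2 ^ b)
    (hML : ((M + 1) * (L2 + 2) : ℝ) ≤ 2 ^ b)
    (hgain : 3 * H + 64 * R * L2 + 6 ≤ 2 * (M * L1))
    (hΛ : |Λ| * 2 ^ (3 * H + 32 * (R * L2) + 6 + b + b * M + b * (M * L1)) ≤ 1)
    (hv : ∀ u v, u + v < M → ∀ l < L1, ∑ i, (c i : ℝ) * ((r i : ℝ) + s i * m) ^ u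
      * ((t i : ℝ) - s i * L) ^ v * wR x d (r i) (s i) (t i) ^ l = 0) :
    ∀ l < L2, ∑ i, (c i : ℝ) * wR x d (r i) (s i) (t i) ^ l = 0 := by
  intro l hl
  by_contra hne
  set w : ι → ℝ := fun i => wR x d (r i) (s i) (t i) with hw
  set ω : ι → ℝ := fun i => Real.log (w i) with hωd
  have hw0 : ∀ i, 0 < w i := fun i => (log_wR x hx1 hx2 d _ _ _ hd0 hd).1
  have hlw : ∀ i, ω i = r i * Real.log x + t i * Real.log 10
      + s i * Real.log ((d : ℝ) * (3 * x ^ 2 - 1) / 9) :=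
    fun i => (log_wR x hx1 hx2 d _ _ _ hd0 hd).2
  have hexp : ∀ i (k : ℕ), Real.exp (ω i * k) = w i ^ k := by
    intro i k
    rw [mul_comm, Real.exp_nat_mul, hωd, Real.exp_log (hw0 i)]
  have hR1 : (1 : ℝ) ≤ R := by exact_mod_cast hR
  have hΛ5 : |Λ| ≤ 0.2 := by
    have h6 : (2 : ℝ) ^ 6 ≤ 2 ^ (3 * H + 32 * (R * L2) + 6 + b + b * M + b * (M * L1)) :=
      pow_le_pow_right₀ (by norm_num) (by omega)
    have h7 := mul_le_mul_of_nonneg_left h6 (abs_nonneg Λ)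
    norm_num at h7
    linarith
  have hθ := (log_theta x hx1 hx2 d hd0 hd)
  have hlx0 : 0 ≤ Real.log x := Real.log_nonneg hx1.le
  have hlx1 : Real.log x ≤ 0.33 := by
    have := Real.log_le_sub_one_of_pos (show 0 < x by linarith)
    linarith
  have hl10 : 0 ≤ Real.log 10 := Real.log_nonneg (by norm_num)
  have hl10' := log_ten_lt
  have hω48 : ∀ i, |ω i| ≤ 4.8 * R := by
    intro i
    have h1 : (r i : ℝ) ≤ R := by exact_mod_cast hr i
    have h2 : (s i : ℝ) ≤ R := by exact_mod_cast hs i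
    have h3 : (t i : ℝ) ≤ R := by exact_mod_cast ht i
    rw [hlw i]
    refine (abs_add_le _ _).trans ?_
    refine (add_le_add_left (abs_add_le _ _) _).trans ?_
    rw [abs_mul, abs_mul, abs_mul, abs_of_nonneg hlx0, abs_of_nonneg hl10]
    simp only [Nat.abs_cast]
    calc _ ≤ (R : ℝ) * 0.33 + R * 2.32 + R * 2.08 := by
          have := hθ.2
          gcongr
      _ ≤ _ := by linarith
  have hdiff : ∀ i, ω i - (((r i : ℝ) + s i * m) * Real.log x + ((t i : ℝ) - s i * L) * Real.log 10)
      = - (s i * Λ) := by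
    intro i
    rw [hlw i, hΛdef]
    ring
  have hη : ∀ i, |ω i - (((r i : ℝ) + s i * m) * Real.log x
      + ((t i : ℝ) - s i * L) * Real.log 10)| ≤ R * |Λ| := by
    intro i
    rw [hdiff i, abs_neg, abs_mul, Nat.abs_cast]
    gcongr
    exact hs i
  have hωprime : ∀ i, |((r i : ℝ) + s i * m) * Real.log x + ((t i : ℝ) - s i * L) * Real.log 10|
      ≤ 5 * R := by
    intro i
    have e : ((r i : ℝ) + s i * m) * Real.log x + ((t i : ℝ) - s i * L) * Real.log 10
      = ω i - (ω i - (((r i : ℝ) + s i * m) * Real.log x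
        + ((t i : ℝ) - s i * L) * Real.log 10)) := by ring
    rw [e]
    refine (abs_sub _ _).trans ?_
    have h1 := hω48 i
    have h2 := hη i
    nlinarith
  have hL2' : (1 : ℝ) ≤ L2 := by exact_mod_cast hL1.trans hL12
  have hext := extrap (fun i => (c i : ℝ)) (fun i => (r i : ℝ) + s i * m)
    (fun i => (t i : ℝ) - s i * L) ω (Real.log x) (Real.log 10) (R * |Λ|) (5 * R) (2 ^ H) L1 M L2
    (fun i => (hω48 i).trans (by linarith)) hωprime hη (by positivity) (by linarith) hc
    (by
      intro u v huv l hl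
      simp only [hexp]
      exact hv u v huv l hl) hL2' (by exact_mod_cast hL12) l (by positivity)
    (by exact_mod_cast hl.le)
  simp only [hexp] at hext
  set A : ℝ := ∑ i, (c i : ℝ) * w i ^ l with hA
  set V : ℤ × ℤ × ℤ := ∑ i, (c i) • wv d R (r i) (s i) (t i) l with hV
  have hVA : evT x V = 9 ^ (R * l) * A := by
    rw [hV, evT_sum, hA, Finset.mul_sum]
    refine Finset.sum_congr rfl fun i _ => ?_
    rw [evT_smul, evT_wv x hx _ _ _ _ _ _ (hs i), hw]
    simp only [wR]
    ring
  have hV0 : V ≠ 0 := by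
    intro h0
    rw [h0] at hVA
    have : evT x 0 = 0 := by simp [evT]
    rw [this] at hVA
    have h9 : (9 : ℝ) ^ (R * l) ≠ 0 := by positivity
    exact hne ((mul_eq_zero.1 hVA.symm).resolve_left h9)
  have hsz : (szT V : ℝ) ≤ 2 ^ (H + 10 * (R * L2)) := by
    have h1 : (szT V : ℝ) ≤ ∑ i, |(c i : ℝ)| * 2 ^ (10 * (R * L2)) := by
      have h2 := szT_sum Finset.univ (fun i => (c i) • wv d R (r i) (s i) (t i) l)
      have h3 : ((szT V : ℤ) : ℝ)
          ≤ ((∑ i, szT ((c i) • wv d R (r i) (s i) (t i) l) : ℤ) : ℝ) := by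
        exact_mod_cast h2
      refine h3.trans ?_
      push_cast
      refine Finset.sum_le_sum fun i _ => ?_
      rw [szT_smul]
      push_cast
      gcongr
      have h4 := szT_wv d R (r i) (s i) (t i) l hd (hs i) (hr i) (ht i)
      have h5 : ((szT (wv d R (r i) (s i) (t i) l) : ℤ) : ℝ) ≤ 2 ^ (10 * R * l) := by
        exact_mod_cast h4
      refine h5.trans (pow_le_pow_right₀ (by norm_num) ?_)
      rw [mul_assoc]
      gcongr
    refine h1.trans ?_
    rw [← Finset.sum_mul, pow_add]
    gcongr
  have hli := liouvilleT x hx (by linarith) (by linarith) V hV0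
  have hsz0 : (0 : ℝ) ≤ szT V := by exact_mod_cast szT_nonneg V
  have h9 : (9 : ℝ) ^ (R * l) ≤ 2 ^ (4 * (R * L2)) := by
    calc (9 : ℝ) ^ (R * l) ≤ (2 ^ 4) ^ (R * l) := by gcongr; norm_num
      _ = 2 ^ (4 * (R * l)) := by rw [← pow_mul]
      _ ≤ _ := pow_le_pow_right₀ (by norm_num) (by gcongr)
  have hone : 1 ≤ |A| * 2 ^ (2 * H + 24 * (R * L2) + 4) := by
    refine hli.trans ?_
    rw [hVA, abs_mul, abs_of_pos (by positivity : (0 : ℝ) < 9 ^ (R * l))]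
    calc 9 ^ (R * l) * |A| * (16 * (szT V : ℝ) ^ 2)
        ≤ 2 ^ (4 * (R * L2)) * |A| * (2 ^ 4 * (2 ^ (H + 10 * (R * L2))) ^ 2) := by
          gcongr
          norm_num
      _ = |A| * (2 ^ (4 * (R * L2)) * (2 ^ 4 * (2 ^ (H + 10 * (R * L2))) ^ 2)) := by ring
      _ = _ := by
          congr 1
          rw [← pow_mul, ← pow_add, ← pow_add]
          congr 1
          ring
  set Z : ℝ := 2 ^ (2 * H + 24 * (R * L2) + 4) with hZ
  have hZ0 : 0 < Z := by positivity
  -- first term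
  have ht1 : (2 ^ H * Real.exp (5 * L2 * (5 * R)) / 4 ^ (M * L1)) * Z ≤ 1 / 4 := by
    have e1 : Real.exp (5 * L2 * (5 * R)) ≤ 2 ^ (8 * (5 * (R * L2))) := by
      refine le_trans (le_of_eq ?_) (exp_five_mul_le (5 * (R * L2)))
      congr 1
      push_cast
      ring
    rw [div_mul_eq_mul_div, div_le_div_iff₀ (by positivity) (by norm_num)]
    calc 2 ^ H * Real.exp (5 * L2 * (5 * R)) * Z * 4
        ≤ 2 ^ H * 2 ^ (8 * (5 * (R * L2))) * Z * 2 ^ 2 := by gcongr; norm_num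
      _ = 2 ^ (3 * H + 64 * R * L2 + 6) := by
          rw [hZ, ← pow_add, ← pow_add, ← pow_add]
          congr 1
          ring
      _ ≤ 2 ^ (2 * (M * L1)) := pow_le_pow_right₀ (by norm_num) hgain
      _ = 1 * 4 ^ (M * L1) := by rw [pow_mul]; norm_num
  have ht2 : ((2 ^ H * (M * (5 * R) ^ M * (R * |Λ|)) * Real.exp (L2 * (5 * R))) *
      ((M + 1) * (L2 + 2)) ^ (M * L1)) * Z ≤ 1 / 4 := by
    have e1 : Real.exp (L2 * (5 * R)) ≤ 2 ^ (8 * (R * L2)) := by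
      refine le_trans (le_of_eq ?_) (exp_five_mul_le (R * L2))
      congr 1
      push_cast
      ring
    have e2 : (5 * R : ℝ) ^ M ≤ 2 ^ (b * M) := by
      rw [pow_mul]
      gcongr
    have e3 : ((M + 1) * (L2 + 2) : ℝ) ^ (M * L1) ≤ 2 ^ (b * (M * L1)) := by
      rw [pow_mul (2 : ℝ) b]
      gcongr
    calc ((2 ^ H * (M * (5 * R) ^ M * (R * |Λ|)) * Real.exp (L2 * (5 * R))) *
          ((M + 1) * (L2 + 2)) ^ (M * L1)) * Z
        = |Λ| * (2 ^ H * (M * R) * (5 * R) ^ M * Real.exp (L2 * (5 * R)) *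
          ((M + 1) * (L2 + 2)) ^ (M * L1) * Z) := by ring
      _ ≤ |Λ| * (2 ^ H * 2 ^ b * 2 ^ (b * M) * 2 ^ (8 * (R * L2)) * 2 ^ (b * (M * L1)) * Z) := by
          gcongr
      _ = |Λ| * 2 ^ (3 * H + 32 * (R * L2) + 6 + b + b * M + b * (M * L1)) * (1 / 4) := by
          rw [hZ, show 3 * H + 32 * (R * L2) + 6 + b + b * M + b * (M * L1)
            = 2 + (H + b + b * M + 8 * (R * L2) + b * (M * L1) + (2 * H + 24 * (R * L2) + 4)) by ring,
            pow_add 2 2, pow_add, pow_add, pow_add, pow_add, pow_add]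
          ring
      _ ≤ 1 * (1 / 4) := by gcongr
      _ = _ := by norm_num
  have := mul_le_mul_of_nonneg_right hext hZ0.le
  rw [add_mul] at this
  linarith


/-! ### Part 3e: the transcendence argument -/

theorem pow_growth (b : ℕ) (hb : 300 ≤ b) : 2 ^ 130 * b ^ 17 ≤ 2 ^ b := by
  induction b, hb using Nat.le_induction with
  | base =>
    have h : (300 : ℕ) ^ 17 ≤ 2 ^ 170 := by norm_num
    calc 2 ^ 130 * 300 ^ 17 ≤ 2 ^ 130 * 2 ^ 170 := Nat.mul_le_mul_left _ h
      _ = 2 ^ 300 := by rw [← pow_add]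
  | succ b hb ih =>
    have h1 : (300 * (b + 1)) ^ 17 ≤ (301 * b) ^ 17 := Nat.pow_le_pow_left (by omega) 17
    rw [mul_pow, mul_pow] at h1
    have h2 : (b + 1) ^ 17 ≤ 2 * b ^ 17 := by
      have h3 : 301 ^ 17 ≤ 2 * 300 ^ 17 := by norm_num
      have h4 : 300 ^ 17 * (b + 1) ^ 17 ≤ 300 ^ 17 * (2 * b ^ 17) := by
        calc _ ≤ 301 ^ 17 * b ^ 17 := h1
          _ ≤ (2 * 300 ^ 17) * b ^ 17 := by gcongr
          _ = _ := by ring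
      exact Nat.le_of_mul_le_mul_left h4 (by positivity)
    calc 2 ^ 130 * (b + 1) ^ 17 ≤ 2 ^ 130 * (2 * b ^ 17) := by gcongr
      _ = 2 * (2 ^ 130 * b ^ 17) := by ring
      _ ≤ 2 * 2 ^ b := by gcongr
      _ = 2 ^ (b + 1) := by ring

theorem auxiliary_exists (x : ℝ) (hx : x ^ 3 = x + 1) 
    (d : ℕ) (hd : d ≤ 9) (m L R b K Lp : ℕ)
    (hm : m + 1 ≤ 2 ^ b) (hL : L + 1 ≤ 2 ^ b) (hRb : R ^ 3 ≤ 2 ^ b) (hR : 1 ≤ R)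
    (hK : 1 ≤ K) (hLp : 1 ≤ Lp) (hcard : 6 * (K ^ 2 * Lp) ≤ R ^ 3) :
    ∃ p : Fin R × Fin R × Fin R → ℤ, p ≠ 0 ∧
      (∀ k1 k2, k1 + k2 < K → ∑ i, |((p i * ((i.1 : ℤ) + i.2.1 * m) ^ k1
        * ((i.2.2 : ℤ) - i.2.1 * L) ^ k2 : ℤ) : ℝ)| ≤ 2 ^ (2 * b + 6 * K * b + 10 * R * Lp)) ∧
      ∀ k1 k2, k1 + k2 < K → ∀ l < Lp, ∑ i, ((p i * ((i.1 : ℤ) + i.2.1 * m) ^ k1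
        * ((i.2.2 : ℤ) - i.2.1 * L) ^ k2 : ℤ) : ℝ) * wR x d i.1 i.2.1 i.2.2 ^ l = 0 := by
  set ι := Fin R × Fin R × Fin R
  set X : ι → ℤ := fun i => (i.1 : ℤ) + i.2.1 * m with hX
  set Y : ι → ℤ := fun i => (i.2.2 : ℤ) - i.2.1 * L with hY
  have hRle : (R : ℤ) ≤ 2 ^ b := by
    have : R ^ 1 ≤ R ^ 3 := Nat.pow_le_pow_right hR (by norm_num)
    rw [pow_one] at this
    have : R ≤ 2 ^ b := this.trans hRb
    exact_mod_cast this
  have hlt : ∀ (i : Fin R), ((i : ℕ) : ℤ) ≤ R := fun i => by exact_mod_cast i.2.le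
  have hpos : ∀ (i : Fin R), (0 : ℤ) ≤ ((i : ℕ) : ℤ) := fun i => by positivity
  have hmZ : (m : ℤ) + 1 ≤ 2 ^ b := by exact_mod_cast hm
  have hLZ : (L : ℤ) + 1 ≤ 2 ^ b := by exact_mod_cast hL
  have hXb : ∀ i, |X i| ≤ 2 ^ (2 * b) := by
    intro i
    have h1 := hlt i.1
    have h2 := hlt i.2.1
    have h3 := hpos i.1
    have h4 := hpos i.2.1
    rw [abs_of_nonneg (by positivity)]
    calc ((i.1 : ℕ) : ℤ) + i.2.1 * m ≤ R + R * m := by gcongr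
      _ = R * (m + 1) := by ring
      _ ≤ 2 ^ b * 2 ^ b := by gcongr
      _ = _ := by rw [← pow_add]; congr 1; ring
  have hYb : ∀ i, |Y i| ≤ 2 ^ (2 * b) := by
    intro i
    have h1 := hlt i.2.2
    have h2 := hlt i.2.1
    have h3 := hpos i.2.2
    have h4 := hpos i.2.1
    refine (abs_sub _ _).trans ?_
    rw [abs_mul, Nat.abs_cast, Nat.abs_cast, Nat.abs_cast]
    calc ((i.2.2 : ℕ) : ℤ) + i.2.1 * L ≤ R + R * L := by gcongr
      _ = R * (L + 1) := by ring
      _ ≤ 2 ^ b * 2 ^ b := by gcongr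
      _ = _ := by rw [← pow_add]; congr 1; ring
  have hXY : ∀ i k1 k2, |X i ^ k1 * Y i ^ k2| ≤ 2 ^ (2 * b * (k1 + k2)) := by
    intro i k1 k2
    rw [abs_mul, abs_pow, abs_pow, mul_add, pow_add, pow_mul _ (2 * b) k1, pow_mul _ (2 * b) k2]
    have h1 := hXb i
    have h2 := hYb i
    gcongr
  let co : ℤ × ℤ × ℤ → Fin 3 → ℤ := fun v => ![v.1, v.2.1, v.2.2]
  have hco : ∀ v e, |co v e| ≤ szT v := by
    intro v e
    have h1 := abs_nonneg v.1
    have h2 := abs_nonneg v.2.1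
    have h3 := abs_nonneg v.2.2
    fin_cases e <;> simp [co, szT] <;> linarith
  obtain ⟨p, hp0, hpz, hpb⟩ := siegelInt
    (fun (k : Fin K × Fin K × Fin Lp × Fin 3) (i : ι) =>
      X i ^ (k.1 : ℕ) * Y i ^ (k.2.1 : ℕ) * co (wv d R i.1 i.2.1 i.2.2 k.2.2.1) k.2.2.2)
    (2 ^ (4 * K * b + 10 * R * Lp)) (one_le_pow₀ (by norm_num))
    (by
      intro k i
      have h1 := hXY i k.1 k.2.1
      have h2 := (hco (wv d R i.1 i.2.1 i.2.2 k.2.2.1) k.2.2.2).trans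
        (szT_wv d R i.1 i.2.1 i.2.2 k.2.2.1 hd i.2.1.2.le i.1.2.le i.2.2.2.le)
      have h3 : |X i ^ (k.1 : ℕ) * Y i ^ (k.2.1 : ℕ) * co (wv d R i.1 i.2.1 i.2.2 k.2.2.1) k.2.2.2|
          ≤ 2 ^ (4 * K * b + 10 * R * Lp) := by
        rw [abs_mul]
        calc _ ≤ (2 : ℤ) ^ (2 * b * (k.1 + k.2.1)) * 2 ^ (10 * R * (k.2.2.1 : ℕ)) := by gcongr
          _ = 2 ^ (2 * b * (k.1 + k.2.1) + 10 * R * (k.2.2.1 : ℕ)) := by rw [← pow_add]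
          _ ≤ _ := by
            apply pow_le_pow_right₀ (by norm_num)
            have a1 : (k.1 : ℕ) ≤ K := k.1.2.le
            have a2 : (k.2.1 : ℕ) ≤ K := k.2.1.2.le
            have a3 : (k.2.2.1 : ℕ) ≤ Lp := k.2.2.1.2.le
            calc _ ≤ 2 * b * (K + K) + 10 * R * Lp := by gcongr
              _ = _ := by ring
      exact_mod_cast h3)
    (by
      simp only [ι, Fintype.card_prod, Fintype.card_fin]
      calc 2 * (K * (K * (Lp * 3))) = 6 * (K ^ 2 * Lp) := by ring
        _ ≤ R ^ 3 := hcard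
        _ = _ := by ring)
    (by
      simp only [Fintype.card_prod, Fintype.card_fin]
      positivity)
  have hcι : (Fintype.card ι : ℝ) = (R : ℝ) ^ 3 := by
    simp only [ι, Fintype.card_prod, Fintype.card_fin]
    push_cast
    ring
  have hR3 : (R : ℝ) ^ 3 ≤ 2 ^ b := by exact_mod_cast hRb
  refine ⟨p, hp0, ?_, ?_⟩
  · intro k1 k2 hk
    calc ∑ i, |((p i * X i ^ k1 * Y i ^ k2 : ℤ) : ℝ)|
        ≤ ∑ i : ι, ((2 : ℝ) ^ b * 2 ^ (4 * K * b + 10 * R * Lp)) * 2 ^ (2 * b * K) := by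
          refine Finset.sum_le_sum fun i _ => ?_
          have h1 := hpb i
          rw [hcι] at h1
          have h2 : |((X i ^ k1 * Y i ^ k2 : ℤ) : ℝ)| ≤ 2 ^ (2 * b * (k1 + k2)) := by
            exact_mod_cast hXY i k1 k2
          rw [mul_assoc, Int.cast_mul, abs_mul]
          have h3 : (2 : ℝ) ^ (2 * b * (k1 + k2)) ≤ 2 ^ (2 * b * K) :=
            pow_le_pow_right₀ (by norm_num) (by gcongr)
          gcongr
          · refine h1.trans ?_
            gcongr
          · exact h2.trans h3
      _ = (R : ℝ) ^ 3 * (((2 : ℝ) ^ b * 2 ^ (4 * K * b + 10 * R * Lp)) * 2 ^ (2 * b * K)) := by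
          rw [Finset.sum_const, nsmul_eq_mul, Finset.card_univ, hcι]
      _ ≤ 2 ^ b * (((2 : ℝ) ^ b * 2 ^ (4 * K * b + 10 * R * Lp)) * 2 ^ (2 * b * K)) := by gcongr
      _ = _ := by
          rw [← pow_add, ← pow_add, ← pow_add]
          congr 1
          ring
  · intro k1 k2 hk l hl
    set V : ℤ × ℤ × ℤ := ∑ i, (p i * X i ^ k1 * Y i ^ k2) • wv d R i.1 i.2.1 i.2.2 l with hV
    have hVA : evT x V = 9 ^ (R * l) * ∑ i, ((p i * X i ^ k1 * Y i ^ k2 : ℤ) : ℝ)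
        * wR x d i.1 i.2.1 i.2.2 ^ l := by
      rw [hV, evT_sum, Finset.mul_sum]
      refine Finset.sum_congr rfl fun i _ => ?_
      rw [evT_smul, evT_wv x hx _ _ _ _ _ _ i.2.1.2.le]
      simp only [wR]
      ring
    have hV0 : V = 0 := by
      have hz : ∀ e, ∑ i, (p i * X i ^ k1 * Y i ^ k2) * co (wv d R i.1 i.2.1 i.2.2 l) e = 0 := by
        intro e
        have := hpz (⟨k1, by omega⟩, ⟨k2, by omega⟩, ⟨l, hl⟩, e)
        rw [← this]
        refine Finset.sum_congr rfl fun i _ => ?_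
        simp only
        ring
      ext
      · have := hz 0
        simpa [hV, co, Prod.fst_sum, Prod.snd_sum] using this
      · have := hz 1
        simpa [hV, co, Prod.fst_sum, Prod.snd_sum] using this
      · have := hz 2
        simpa [hV, co, Prod.fst_sum, Prod.snd_sum] using this
    rw [hV0] at hVA
    have : evT x 0 = 0 := by simp [evT]
    rw [this] at hVA
    have h9 : (9 : ℝ) ^ (R * l) ≠ 0 := by positivity
    exact (mul_eq_zero.1 hVA.symm).resolve_left h9


/-! ### Part 3f: the lower bound for the linear form -/

theorem numerics (b R : ℕ) (hb : 300 ≤ b) (hR : R = 2 ^ 22 * b ^ 4) :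
    522 * R ^ 4 ≤ 2 ^ b := by
  have h := pow_growth b hb
  have h1 : 522 * R ^ 4 = 522 * 2 ^ 88 * b ^ 16 := by rw [hR]; ring
  have h2 : b ^ 16 ≤ b ^ 17 := Nat.pow_le_pow_right (by omega) (by norm_num)
  rw [h1]
  refine le_trans ?_ h
  exact Nat.mul_le_mul (by norm_num) h2

theorem baker_main (x : ℝ) (hx : x ^ 3 = x + 1) (hx1 : 1 < x) (hx2 : x < 1.33)
    (d : ℕ) (hd0 : 0 < d) (hd : d ≤ 9) (m L b R : ℕ) (hb : 300 ≤ b) (hR : R = 2 ^ 22 * b ^ 4)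
    (hm : m + 1 ≤ 2 ^ b) (hL : L + 1 ≤ 2 ^ b) (Λ : ℝ)
    (hΛdef : Λ = m * Real.log x - L * Real.log 10 - Real.log ((d : ℝ) * (3 * x ^ 2 - 1) / 9)) :
    1 < |Λ| * 2 ^ (200 * b * R ^ 4) := by
  by_contra hcon
  push Not at hcon
  have hnum := numerics b R hb hR
  have hb4 : 1 ≤ b ^ 4 := Nat.one_le_pow _ _ (by omega)
  have hR1 : 1000 ≤ R := by rw [hR]; omega
  have hbR4 : 4 * b ≤ R := by
    have : b ^ 1 ≤ b ^ 4 := Nat.pow_le_pow_right (by omega) (by norm_num)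
    rw [pow_one] at this
    rw [hR]; omega
  have hbR : b ≤ R := by omega
  have hb2R : 18 * b ^ 2 ≤ R := by
    have : b ^ 2 ≤ b ^ 4 := Nat.pow_le_pow_right (by omega) (by norm_num)
    rw [hR]; omega
  obtain ⟨M, hM⟩ : ∃ M, M = 173 * R := ⟨_, rfl⟩
  obtain ⟨Lp, hLp⟩ : ∃ Lp, Lp = 18 * b ^ 2 := ⟨_, rfl⟩
  obtain ⟨K, hK⟩ : ∃ K, K = b * M + 1 := ⟨_, rfl⟩
  have hLp1 : 1 ≤ Lp := by
    have : 1 ≤ b ^ 2 := Nat.one_le_pow _ _ (by omega)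
    omega
  have hR34 : R ^ 3 ≤ R ^ 4 := Nat.pow_le_pow_right (by omega) (by norm_num)
  have hR13 : R ≤ R ^ 3 := by
    have : R ^ 1 ≤ R ^ 3 := Nat.pow_le_pow_right (by omega) (by norm_num)
    rwa [pow_one] at this
  have hR24 : R ^ 2 ≤ R ^ 4 := Nat.pow_le_pow_right (by omega) (by norm_num)
  have hRb : R ^ 3 ≤ 2 ^ b := by omega
  have hKle : K ≤ 174 * (b * R) := by
    have : 1 ≤ b * R := Nat.mul_pos (by omega) (by omega)
    rw [hK, hM]
    calc b * (173 * R) + 1 = 173 * (b * R) + 1 := by ring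
      _ ≤ _ := by omega
  have hcard : 6 * (K ^ 2 * Lp) ≤ R ^ 3 := by
    calc 6 * (K ^ 2 * Lp) ≤ 6 * ((174 * (b * R)) ^ 2 * Lp) := by gcongr
      _ = 3269808 * (b ^ 4 * R ^ 2) := by rw [hLp]; ring
      _ ≤ 2 ^ 22 * (b ^ 4 * R ^ 2) := Nat.mul_le_mul_right _ (by norm_num)
      _ = (2 ^ 22 * b ^ 4) * R ^ 2 := by ring
      _ = R ^ 3 := by rw [← hR]; ring
  obtain ⟨p, hp0, hpb, hpz⟩ := auxiliary_exists x hx d hd m L R b K Lp hm hL hRb (by omega)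
    (by omega) hLp1 hcard
  obtain ⟨H, hH⟩ : ∃ H, H = 2 * b + 6 * K * b + 10 * R * Lp := ⟨_, rfl⟩
  rw [← hH] at hpb
  have key : ∀ j, j ≤ b → ∀ k1 k2, k1 + k2 + j * M < K → ∀ l < min (2 ^ j * Lp) (R ^ 3),
      ∑ i, ((p i * ((i.1 : ℤ) + i.2.1 * m) ^ k1
        * ((i.2.2 : ℤ) - i.2.1 * L) ^ k2 : ℤ) : ℝ) * wR x d i.1 i.2.1 i.2.2 ^ l = 0 := by
    intro j
    induction j with
    | zero =>
      intro _ k1 k2 hk l hl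
      exact hpz k1 k2 (by omega) l (by
        have := lt_of_lt_of_le hl (min_le_left _ _)
        simpa using this)
    | succ j ih =>
      intro hj k1 k2 hk
      obtain ⟨L1, hL1⟩ : ∃ L1, L1 = min (2 ^ j * Lp) (R ^ 3) := ⟨_, rfl⟩
      obtain ⟨L2, hL2⟩ : ∃ L2, L2 = min (2 ^ (j + 1) * Lp) (R ^ 3) := ⟨_, rfl⟩
      have ih' := ih (by omega)
      rw [← hL1] at ih'
      rw [← hL2]
      have hpow : 2 ^ (j + 1) * Lp = 2 * (2 ^ j * Lp) := by ring
      have hjLp : Lp ≤ 2 ^ j * Lp := Nat.le_mul_of_pos_left _ (by positivity)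
      have hLpL1 : Lp ≤ L1 := by
        rw [hL1]; exact le_min hjLp (by omega)
      have hL1R : L1 ≤ R ^ 3 := hL1 ▸ min_le_right _ _
      have hL2R : L2 ≤ R ^ 3 := hL2 ▸ min_le_right _ _
      have hL12 : L1 ≤ L2 := by rw [hL1, hL2, hpow]; omega
      have hL21 : L2 ≤ 2 * L1 := by rw [hL1, hL2, hpow]; omega
      have hKM : K * b ≤ 174 * (b ^ 2 * R) := by
        calc K * b ≤ (174 * (b * R)) * b := by gcongr
          _ = _ := by ring
      have hRL1 : R ≤ R * L1 := Nat.le_mul_of_pos_right _ (by omega)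
      have hbig : R * R ^ 3 = R ^ 4 := by ring
      have hRL1R : R * L1 ≤ R ^ 4 := by rw [← hbig]; gcongr
      have hRL2R : R * L2 ≤ R ^ 4 := by rw [← hbig]; gcongr
      have hRL2L1 : R * L2 ≤ 2 * (R * L1) := by
        calc R * L2 ≤ R * (2 * L1) := by gcongr
          _ = _ := by ring
      have h3H : 3 * H ≤ 203 * (R * L1) + 24 * b := by
        have e1 : 18 * (K * b) = R * (173 * (18 * b ^ 2)) + 18 * b := by
          rw [hK, hM]; ring
        have e2 : R * (173 * (18 * b ^ 2)) ≤ 173 * (R * L1) := by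
          rw [← hLp]
          calc R * (173 * Lp) ≤ R * (173 * L1) := by gcongr
            _ = _ := by ring
        have e3 : R * Lp ≤ R * L1 := by gcongr
        calc 3 * H = 6 * b + 18 * (K * b) + 30 * (R * Lp) := by rw [hH]; ring
          _ ≤ _ := by omega
      refine baker_step x hx hx1 hx2 d hd0 hd m L R b H M L1 L2
        (fun i : Fin R × Fin R × Fin R => (i.1 : ℕ)) (fun i => (i.2.1 : ℕ)) (fun i => (i.2.2 : ℕ))
        (fun i => i.1.2.le) (fun i => i.2.1.2.le) (fun i => i.2.2.2.le)
        (fun i => p i * ((i.1 : ℤ) + i.2.1 * m) ^ k1 * ((i.2.2 : ℤ) - i.2.1 * L) ^ k2)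
        (hpb k1 k2 (by omega)) Λ hΛdef (by omega) (by omega) hL12 ?_ ?_ ?_ ?_ ?_ ?_
      · have : 5 * R ≤ 2 ^ b := by omega
        exact_mod_cast this
      · have : M * R ≤ 2 ^ b := by
          have : M * R = 173 * R ^ 2 := by rw [hM]; ring
          omega
        exact_mod_cast this
      · have : (M + 1) * (L2 + 2) ≤ 2 ^ b := by
          calc (M + 1) * (L2 + 2) ≤ (174 * R) * (3 * R ^ 3) := by
                apply Nat.mul_le_mul <;> omega
            _ = 522 * R ^ 4 := by ring
            _ ≤ _ := hnum
        exact_mod_cast this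
      · have : 2 * (M * L1) = 346 * (R * L1) := by rw [hM]; ring
        have : 64 * R * L2 = 64 * (R * L2) := by ring
        omega
      · refine le_trans (mul_le_mul_of_nonneg_left ?_ (abs_nonneg _)) hcon
        apply pow_le_pow_right₀ (by norm_num)
        have e1 : b * (M * L1) ≤ 173 * (b * R ^ 4) := by
          calc b * (M * L1) = 173 * (b * (R * L1)) := by rw [hM]; ring
            _ ≤ _ := by gcongr
        have e2 : b * M ≤ 173 * R ^ 4 := by
          calc b * M ≤ R * M := by gcongr
            _ = 173 * R ^ 2 := by rw [hM]; ring
            _ ≤ _ := by gcongr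
        have e3 : 300 * R ^ 4 ≤ b * R ^ 4 := by gcongr
        have e4 : 200 * b * R ^ 4 = 200 * (b * R ^ 4) := by ring
        rw [e4]
        omega
      · intro u v huv l hl
        have := ih' (k1 + u) (k2 + v) (by
          have : (j + 1) * M = j * M + M := by ring
          omega) l hl
        rw [← this]
        refine Finset.sum_congr rfl fun i _ => ?_
        push_cast
        ring
  have hfin : ∀ l < R ^ 3, ∑ i, (p i : ℝ) * wR x d i.1 i.2.1 i.2.2 ^ l = 0 := by
    intro l hl
    have := key b le_rfl 0 0 (by omega) l (by
      refine lt_min (lt_of_lt_of_le hl ?_) hl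
      exact hRb.trans (Nat.le_mul_of_pos_right _ (by omega)))
    simpa using this
  have hcardι : Fintype.card (Fin R × Fin R × Fin R) = R ^ 3 := by
    simp only [Fintype.card_prod, Fintype.card_fin]; ring
  let e := (Fintype.equivFinOfCardEq hcardι).symm
  have hinj : Function.Injective (fun k : Fin (R ^ 3) => wR x d (e k).1 (e k).2.1 (e k).2.2) := by
    intro k k' h
    apply e.injective
    obtain ⟨a1, a2, a3⟩ := w_inj x hx hx1 (by linarith) d R hd0 hd _ _ _ _ _ _
      (e k).2.1.2.le (e k').2.1.2.le h
    exact Prod.ext (Fin.ext a1) (Prod.ext (Fin.ext a2) (Fin.ext a3))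
  have hz := Matrix.eq_zero_of_forall_pow_sum_mul_pow_eq_zero
    (f := fun k : Fin (R ^ 3) => wR x d (e k).1 (e k).2.1 (e k).2.2)
    (v := fun k => (p (e k) : ℝ)) hinj (by
      intro l
      rw [← hfin l l.2]
      exact Equiv.sum_comp e (fun i => (p i : ℝ) * wR x d i.1 i.2.1 i.2.2 ^ (l : ℕ)))
  apply hp0
  funext i
  have := congrFun hz (e.symm i)
  simp only [Equiv.apply_symm_apply, Pi.zero_apply] at this
  exact_mod_cast this


/-! ### Part 4: the reduction step -/

/-- Call-by-value application; it keeps kernel evaluation fast. -/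
def force {β : Type} (n : ℕ) (f : ℕ → β) : β := Nat.rec (f 0) (fun k _ => f (k + 1)) n

theorem force_eq {β : Type} (n : ℕ) (f : ℕ → β) : force n f = f n := by
  cases n <;> rfl

def pack (A B e k : ℕ) : ℕ × ℕ × ℕ × ℕ :=
  force A fun A => force B fun B => force e fun e => force k fun k => (A, B, e, k)

theorem pack_eq (A B e k : ℕ) : pack A B e k = (A, B, e, k) := by
  simp only [pack, force_eq]

/-- Interval exponentiation with decimal mantissas: the state is (lower, upper, exponent, power). -/
def nrm (N : ℕ) : ℕ × ℕ × ℕ × ℕ → ℕ × ℕ × ℕ × ℕ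
  | (A, B, e, k) =>
    if 10 ^ (N + 1) ≤ A then pack (A / 10) (B / 10 + 1) (e + 1) k else (A, B, e, k)

def sqr (N : ℕ) : ℕ × ℕ × ℕ × ℕ → ℕ × ℕ × ℕ × ℕ
  | (A, B, e, k) => nrm N (pack (A * A / 10 ^ N) (B * B / 10 ^ N + 1) (e + e) (k + k))

def mlt (N A0 B0 : ℕ) : ℕ × ℕ × ℕ × ℕ → ℕ × ℕ × ℕ × ℕ
  | (A, B, e, k) => nrm N (nrm N (pack (A * A0 / 10 ^ N) (B * B0 / 10 ^ N + 1) (e + 0) (k + 1)))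

def stp (N A0 B0 : ℕ) (s : ℕ × ℕ × ℕ × ℕ) (c : ℕ) : ℕ × ℕ × ℕ × ℕ :=
  if c = 0 then sqr N s else mlt N A0 B0 (sqr N s)

/-- Consume `j` binary digits of `q`, most significant first. -/
def run (N A0 B0 q : ℕ) : ℕ → ℕ × ℕ × ℕ × ℕ
  | 0 => (10 ^ N, 10 ^ N, 0, 0)
  | j + 1 => force (q / 2) fun q' => stp N A0 B0 (run N A0 B0 q' j) (q % 2)

def Good (N : ℕ) (y : ℝ) (s : ℕ × ℕ × ℕ × ℕ) : Prop :=
  (s.1 : ℝ) * 10 ^ s.2.2.1 ≤ y ^ s.2.2.2 * 10 ^ N ∧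
    y ^ s.2.2.2 * 10 ^ N ≤ (s.2.1 : ℝ) * 10 ^ s.2.2.1

theorem good_nrm (N : ℕ) (s : ℕ × ℕ × ℕ × ℕ) (y : ℝ) (h : Good N y s) :
    Good N y (nrm N s) := by
  obtain ⟨A, B, e, k⟩ := s
  simp only [nrm, pack_eq]
  split_ifs with hc
  · obtain ⟨h1, h2⟩ := h
    simp only at h1 h2
    constructor
    · refine le_trans ?_ h1
      simp only
      have : ((A / 10 : ℕ) : ℝ) * 10 ≤ A := by exact_mod_cast Nat.div_mul_le_self A 10
      calc ((A / 10 : ℕ) : ℝ) * 10 ^ (e + 1) = ((A / 10 : ℕ) : ℝ) * 10 * 10 ^ e := by ring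
        _ ≤ A * 10 ^ e := by gcongr
    · refine h2.trans ?_
      simp only
      have : (B : ℝ) ≤ ((B / 10 + 1 : ℕ) : ℝ) * 10 := by
        have : B ≤ (B / 10 + 1) * 10 := by omega
        exact_mod_cast this
      calc (B : ℝ) * 10 ^ e ≤ (((B / 10 + 1 : ℕ) : ℝ) * 10) * 10 ^ e := by gcongr
        _ = _ := by ring
  · exact h

theorem good_mul (N A B e k A' B' e' k' : ℕ) (y : ℝ) (hy : 0 ≤ y) (h : Good N y (A, B, e, k))
    (h' : Good N y (A', B', e', k')) :
    Good N y (A * A' / 10 ^ N, B * B' / 10 ^ N + 1, e + e', k + k') := by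
  obtain ⟨h1, h2⟩ := h
  obtain ⟨h3, h4⟩ := h'
  simp only at h1 h2 h3 h4
  have hp : (0 : ℝ) < 10 ^ N := by positivity
  constructor
  · simp only
    refine le_of_mul_le_mul_right ?_ hp
    have : ((A * A' / 10 ^ N : ℕ) : ℝ) * 10 ^ N ≤ A * A' := by
      exact_mod_cast Nat.div_mul_le_self (A * A') (10 ^ N)
    calc ((A * A' / 10 ^ N : ℕ) : ℝ) * 10 ^ (e + e') * 10 ^ N
        = (((A * A' / 10 ^ N : ℕ) : ℝ) * 10 ^ N) * (10 ^ e * 10 ^ e') := by rw [pow_add]; ring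
      _ ≤ (A * A') * (10 ^ e * 10 ^ e') := by gcongr
      _ = (A * 10 ^ e) * (A' * 10 ^ e') := by ring
      _ ≤ (y ^ k * 10 ^ N) * (y ^ k' * 10 ^ N) := by gcongr
      _ = _ := by rw [pow_add]; ring
  · simp only
    refine le_of_mul_le_mul_right ?_ hp
    have : (B : ℝ) * B' ≤ ((B * B' / 10 ^ N + 1 : ℕ) : ℝ) * 10 ^ N := by
      have : B * B' ≤ (B * B' / 10 ^ N + 1) * 10 ^ N :=
        (Nat.lt_mul_div_succ (B * B') (by positivity)).le.trans (mul_comm _ _).le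
      exact_mod_cast this
    calc y ^ (k + k') * 10 ^ N * 10 ^ N = (y ^ k * 10 ^ N) * (y ^ k' * 10 ^ N) := by
          rw [pow_add]; ring
      _ ≤ (B * 10 ^ e) * (B' * 10 ^ e') := by gcongr
      _ = (B * B') * (10 ^ e * 10 ^ e') := by ring
      _ ≤ (((B * B' / 10 ^ N + 1 : ℕ) : ℝ) * 10 ^ N) * (10 ^ e * 10 ^ e') := by gcongr
      _ = _ := by rw [pow_add]; ring

theorem good_run (N A0 B0 : ℕ) (y : ℝ) (hy : 0 ≤ y) (h0 : Good N y (A0, B0, 0, 1)) (j : ℕ) :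
    ∀ q, Good N y (run N A0 B0 q j) := by
  induction j with
  | zero => intro q; simp [run, Good]
  | succ j ih =>
    intro q
    have h1 := ih (q / 2)
    rw [run, force_eq]
    generalize run N A0 B0 (q / 2) j = s at h1
    obtain ⟨A, B, e, k⟩ := s
    have h2 : Good N y (sqr N (A, B, e, k)) := by
      simp only [sqr, pack_eq]
      exact good_nrm _ _ _ (good_mul _ _ _ _ _ _ _ _ _ _ hy h1 h1)
    unfold stp
    split_ifs with hc
    · exact h2
    · generalize sqr N (A, B, e, k) = t at h2
      obtain ⟨A', B', e', k'⟩ := t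
      simp only [mlt, pack_eq]
      exact good_nrm _ _ _ <| good_nrm _ _ _ (good_mul _ _ _ _ _ _ _ _ _ _ hy h2 h0)

/-- Lower decimal approximation to the real root of `x ^ 3 = x + 1`. -/
def rootA : ℕ :=
  13247179572447460259609088544780973407344040569017333645340150503028278512455475940546993479817872803299109209947422074251089026390458977955943147570967234717541668390388674187517369315842535499082466223545337273504589879

def redQ : ℕ :=
  7118183750294707964014594551246371016453412384326888162919068334069019829239620491013169194712421

def dLow : ℕ := 3 * rootA ^ 2 / 10 ^ 220 - 10 ^ 220
def dUp : ℕ := 3 * (rootA + 1) ^ 2 / 10 ^ 220 + 1 - 10 ^ 220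
def yLow (d : ℕ) : ℕ := 10 * d * dLow / 9
def yUp (d : ℕ) : ℕ := 10 * d * dUp / 9 + 1

def chkX (A0 B0 : ℕ) : Bool :=
  force A0 fun A0 => force B0 fun B0 => match run 220 A0 B0 redQ 330 with
  | (A, B, _, k) => decide (10 ^ 220 ≤ A) && decide (B ≤ 10 ^ 220 + 10 ^ 124) && decide (k = redQ)

def chkY (A0 B0 : ℕ) : Bool :=
  force A0 fun A0 => force B0 fun B0 => match run 220 A0 B0 redQ 330 with
  | (A, B, _, k) => decide (11 * 10 ^ 219 ≤ A) && decide (B ≤ 9 * 10 ^ 220) && decide (k = redQ)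

theorem chk_x : chkX rootA (rootA + 1) = true := by decide +kernel

theorem chk_y : ((List.range 9).all fun d => chkY (yLow (d + 1)) (yUp (d + 1))) = true := by
  decide +kernel

theorem chk_root : rootA ^ 3 ≤ rootA * 10 ^ 440 + 10 ^ 660 ∧
    (rootA + 1) * 10 ^ 440 + 10 ^ 660 ≤ (rootA + 1) ^ 3 ∧ 10 ^ 220 ≤ rootA ∧
    10 ^ 220 ≤ 3 * rootA ^ 2 / 10 ^ 220 ∧ redQ ≤ 10 ^ 97 := by decide +kernel


theorem cubic_mono (T u v : ℝ) (hT : 0 < T) (hu : T ≤ u) (huv : u < v)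
    (h : v ^ 3 - v * T ^ 2 ≤ u ^ 3 - u * T ^ 2) : False := by
  have h1 : 0 < (v - u) * (v ^ 2 + v * u + u ^ 2 - T ^ 2) := by
    apply mul_pos (by linarith)
    nlinarith
  nlinarith

theorem root_bounds (x : ℝ) (hx : x ^ 3 = x + 1) (hx1 : 1 < x) :
    (rootA : ℝ) ≤ x * 10 ^ 220 ∧ x * 10 ^ 220 ≤ (rootA : ℝ) + 1 := by
  obtain ⟨c1, c2, c3, -, -⟩ := chk_root
  obtain ⟨T, hT⟩ : ∃ T : ℝ, T = 10 ^ 220 := ⟨_, rfl⟩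
  have hT0 : 0 < T := by rw [hT]; positivity
  have d1 : (rootA : ℝ) ^ 3 ≤ rootA * (10 ^ 220) ^ 2 + (10 ^ 220) ^ 3 := by
    rw [← pow_mul, ← pow_mul]
    exact_mod_cast c1
  have d2 : ((rootA : ℝ) + 1) * (10 ^ 220) ^ 2 + (10 ^ 220) ^ 3 ≤ ((rootA : ℝ) + 1) ^ 3 := by
    rw [← pow_mul, ← pow_mul]
    exact_mod_cast c2
  have d3 : (10 : ℝ) ^ 220 ≤ rootA := by exact_mod_cast c3
  rw [← hT] at d1 d2 d3 ⊢
  have hz : (x * T) ^ 3 = (x * T) * T ^ 2 + T ^ 3 := by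
    rw [mul_pow, hx]; ring
  have hzT : T ≤ x * T := by nlinarith
  constructor
  · by_contra hc
    push Not at hc
    exact cubic_mono T _ _ hT0 hzT hc (by linarith)
  · by_contra hc
    push Not at hc
    exact cubic_mono T _ _ hT0 (by linarith) hc (by linarith)

theorem y_bounds (x : ℝ) (hx : x ^ 3 = x + 1) (hx1 : 1 < x) (d : ℕ) :
    (yLow d : ℝ) ≤ (10 * ((d : ℝ) * (3 * x ^ 2 - 1) / 9)) * 10 ^ 220 ∧
    (10 * ((d : ℝ) * (3 * x ^ 2 - 1) / 9)) * 10 ^ 220 ≤ (yUp d : ℝ) := by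
  obtain ⟨r1, r2⟩ := root_bounds x hx hx1
  obtain ⟨-, -, -, c4, -⟩ := chk_root
  have hTp : 0 < (10 : ℕ) ^ 220 := by positivity
  have n1 : (3 * rootA ^ 2 / 10 ^ 220) * 10 ^ 220 ≤ 3 * rootA ^ 2 := Nat.div_mul_le_self _ _
  have n2 : 3 * (rootA + 1) ^ 2 ≤ (3 * (rootA + 1) ^ 2 / 10 ^ 220 + 1) * 10 ^ 220 :=
    (Nat.lt_mul_div_succ _ hTp).le.trans (mul_comm _ _).le
  have n3 : dLow + 10 ^ 220 = 3 * rootA ^ 2 / 10 ^ 220 := Nat.sub_add_cancel c4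
  have c5 : 10 ^ 220 ≤ 3 * (rootA + 1) ^ 2 / 10 ^ 220 + 1 := by
    refine c4.trans (le_trans (Nat.div_le_div_right ?_) (Nat.le_succ _))
    gcongr
    exact Nat.le_succ _
  have n4 : dUp + 10 ^ 220 = 3 * (rootA + 1) ^ 2 / 10 ^ 220 + 1 := Nat.sub_add_cancel c5
  rw [← n3] at n1
  rw [← n4] at n2
  have n5 : yLow d * 9 ≤ 10 * d * dLow := Nat.div_mul_le_self _ _
  have n6 : 10 * d * dUp ≤ yUp d * 9 :=
    (Nat.lt_mul_div_succ _ (by norm_num)).le.trans (mul_comm _ _).le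
  have m1 : ((dLow : ℝ) + 10 ^ 220) * 10 ^ 220 ≤ 3 * (rootA : ℝ) ^ 2 := by exact_mod_cast n1
  have m2 : 3 * ((rootA : ℝ) + 1) ^ 2 ≤ ((dUp : ℝ) + 10 ^ 220) * 10 ^ 220 := by exact_mod_cast n2
  have m5 : (yLow d : ℝ) * 9 ≤ 10 * d * dLow := by exact_mod_cast n5
  have m6 : (10 : ℝ) * d * dUp ≤ yUp d * 9 := by exact_mod_cast n6
  obtain ⟨T, hT⟩ : ∃ T : ℝ, T = 10 ^ 220 := ⟨_, rfl⟩
  have hT0 : 0 < T := by rw [hT]; positivity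
  rw [← hT] at r1 r2 m1 m2 ⊢
  have ha : (0 : ℝ) ≤ rootA := Nat.cast_nonneg _
  have hd : (0 : ℝ) ≤ d := Nat.cast_nonneg _
  have s1 : (rootA : ℝ) ^ 2 ≤ (x * T) ^ 2 := by gcongr
  have s2 : (x * T) ^ 2 ≤ ((rootA : ℝ) + 1) ^ 2 := by gcongr
  have t1 : (dLow : ℝ) ≤ (3 * x ^ 2 - 1) * T := by
    refine le_of_mul_le_mul_right ?_ hT0
    nlinarith
  have t2 : (3 * x ^ 2 - 1) * T ≤ dUp := by
    refine le_of_mul_le_mul_right ?_ hT0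
    nlinarith
  have u1 : (10 : ℝ) * d * dLow ≤ 10 * d * ((3 * x ^ 2 - 1) * T) := by gcongr
  have u2 : 10 * d * ((3 * x ^ 2 - 1) * T) ≤ (10 : ℝ) * d * dUp := by gcongr
  constructor <;> linarith

theorem red_data (x : ℝ) (hx : x ^ 3 = x + 1) (hx1 : 1 < x) :
    ∃ q p : ℕ, (q : ℝ) ≤ 10 ^ 97 ∧ (10 : ℝ) ^ p ≤ x ^ q ∧ x ^ q ≤ 10 ^ p * (1 + 1 / 10 ^ 96) ∧
      ∀ d : ℕ, 0 < d → d ≤ 9 → ∃ e : ℕ, 1.1 * 10 ^ e ≤ (10 * ((d : ℝ) * (3 * x ^ 2 - 1) / 9)) ^ q ∧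
        (10 * ((d : ℝ) * (3 * x ^ 2 - 1) / 9)) ^ q ≤ 9 * 10 ^ e := by
  have hD : 0 ≤ 3 * x ^ 2 - 1 := by nlinarith
  obtain ⟨-, -, -, -, c5⟩ := chk_root
  have gx := good_run 220 rootA (rootA + 1) x (by linarith) (by
    obtain ⟨r1, r2⟩ := root_bounds x hx hx1
    refine ⟨?_, ?_⟩
    · simp only [pow_zero, mul_one, pow_one]; exact r1
    · simp only [pow_zero, mul_one, pow_one]; push_cast; exact r2) 330 redQ
  have cx := chk_x
  simp only [chkX, force_eq] at cx
  have cy := chk_y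
  rw [List.all_eq_true] at cy
  have gy : ∀ d : ℕ, 0 < d → d ≤ 9 → ∃ e : ℕ,
      1.1 * 10 ^ e ≤ (10 * ((d : ℝ) * (3 * x ^ 2 - 1) / 9)) ^ redQ ∧
        (10 * ((d : ℝ) * (3 * x ^ 2 - 1) / 9)) ^ redQ ≤ 9 * 10 ^ e := by
    intro d hd0 hd
    have hmem : d - 1 ∈ List.range 9 := List.mem_range.2 (by omega)
    have c := cy (d - 1) hmem
    beta_reduce at c
    rw [Nat.sub_add_cancel hd0] at c
    obtain ⟨y, hy⟩ : ∃ y : ℝ, y = 10 * ((d : ℝ) * (3 * x ^ 2 - 1) / 9) := ⟨_, rfl⟩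
    have hy0 : 0 ≤ y := by
      rw [hy]
      positivity
    have g := good_run 220 (yLow d) (yUp d) y hy0 (by
      obtain ⟨r1, r2⟩ := y_bounds x hx hx1 d
      rw [hy]
      refine ⟨?_, ?_⟩
      · simp only [pow_zero, mul_one, pow_one]; exact r1
      · simp only [pow_zero, mul_one, pow_one]; exact r2) 330 redQ
    rw [← hy]
    simp only [chkY, force_eq] at c
    clear gx cx cy c5
    revert c g
    generalize run 220 (yLow d) (yUp d) redQ 330 = s
    obtain ⟨A, B, e, k⟩ := s
    generalize redQ = q
    intro g c
    simp only [Bool.and_eq_true, decide_eq_true_eq] at c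
    obtain ⟨⟨a1, a2⟩, rfl⟩ := c
    obtain ⟨g1, g2⟩ := g
    simp only at g1 g2
    have b1 : (11 : ℝ) * 10 ^ 219 ≤ A := by exact_mod_cast a1
    have b2 : (B : ℝ) ≤ 9 * 10 ^ 220 := by exact_mod_cast a2
    refine ⟨e, ?_, ?_⟩
    · refine le_of_mul_le_mul_right (le_trans ?_ g1) (by positivity : (0 : ℝ) < 10 ^ 220)
      calc (1.1 : ℝ) * 10 ^ e * 10 ^ 220 = (11 * 10 ^ 219) * 10 ^ e := by ring
        _ ≤ _ := by gcongr
    · refine le_of_mul_le_mul_right (g2.trans ?_) (by positivity : (0 : ℝ) < 10 ^ 220)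
      calc (B : ℝ) * 10 ^ e ≤ (9 * 10 ^ 220) * 10 ^ e := by gcongr
        _ = _ := by ring
  revert cx gx gy c5
  generalize run 220 rootA (rootA + 1) redQ 330 = s
  obtain ⟨A, B, e, k⟩ := s
  generalize redQ = q
  intro c5 gx cx gy
  simp only [Bool.and_eq_true, decide_eq_true_eq] at cx
  obtain ⟨⟨a1, a2⟩, rfl⟩ := cx
  obtain ⟨g1, g2⟩ := gx
  simp only at g1 g2
  have b1 : (10 : ℝ) ^ 220 ≤ A := by exact_mod_cast a1
  have b2 : (B : ℝ) ≤ 10 ^ 220 + 10 ^ 124 := by exact_mod_cast a2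
  refine ⟨k, e, by exact_mod_cast c5, ?_, ?_, gy⟩
  · refine le_of_mul_le_mul_right (le_trans ?_ g1) (by positivity : (0 : ℝ) < 10 ^ 220)
    calc (10 : ℝ) ^ e * 10 ^ 220 = 10 ^ 220 * 10 ^ e := by ring
      _ ≤ _ := by gcongr
  · refine le_of_mul_le_mul_right (g2.trans ?_) (by positivity : (0 : ℝ) < 10 ^ 220)
    calc (B : ℝ) * 10 ^ e ≤ (10 ^ 220 + 10 ^ 124) * 10 ^ e := by gcongr
      _ = 10 ^ e * ((1 + 1 / 10 ^ 96) * 10 ^ 220) := by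
        have : (10 : ℝ) ^ 220 + 10 ^ 124 = (1 + 1 / 10 ^ 96) * 10 ^ 220 := by norm_num
        rw [this]; ring
      _ = _ := by ring


/-! ### Part 5: asymptotics of the Padovan sequence -/

theorem padovan_id (x : ℝ) (hx : x ^ 3 = x + 1) (n : ℕ) :
    (padovan (n + 2) : ℝ) + x * padovan (n + 1) + (x ^ 2 - 1) * padovan n = x ^ (n + 3) := by
  induction n with
  | zero => simp [padovan]; linarith
  | succ n ih =>
    have h := padovan_rec n
    have e1 : n + 1 + 2 = n + 3 := by ring
    have e2 : n + 1 + 1 = n + 2 := by ring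
    rw [e1, e2, h, show x ^ (n + 1 + 3) = x ^ (n + 3) * x by ring, ← ih]
    push_cast
    linear_combination (-(padovan n : ℝ)) * hx

theorem padovan_err (x : ℝ) (hx : x ^ 3 = x + 1) (hx1 : 1.32 < x) (hx2 : x < 1.33) (n : ℕ) :
    |(3 * x ^ 2 - 1) * (padovan n : ℝ) - x ^ (n + 3)| ≤ 3 := by
  set E : ℕ → ℝ := fun n => (3 * x ^ 2 - 1) * (padovan n : ℝ) - x ^ (n + 3) with hE
  have hrec : ∀ n, E (n + 2) = - x * E (n + 1) - (x ^ 2 - 1) * E n := by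
    intro n
    have h := padovan_id x hx n
    simp only [hE]
    have e1 : x ^ (n + 2 + 3) = x ^ (n + 3) * x ^ 2 := by ring
    have e2 : x ^ (n + 1 + 3) = x ^ (n + 3) * x := by ring
    rw [e1, e2]
    linear_combination (3 * x ^ 2 - 1) * h
  have hx2' : 1.7424 < x ^ 2 := by nlinarith
  have hx2'' : x ^ 2 < 1.7689 := by nlinarith
  have hQ : ∀ n, E (n + 1) ^ 2 + x * E n * E (n + 1) + (x ^ 2 - 1) * E n ^ 2 ≤ 2 := by
    intro n
    induction n with
    | zero =>
      simp only [hE]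
      simp [padovan]
      have e : (3 * x ^ 2 - 1 - x ^ 4) ^ 2 + -(x * x ^ 3 * (3 * x ^ 2 - 1 - x ^ 4)) +
          (x ^ 2 - 1) * (x ^ 3) ^ 2 = 2 * x ^ 2 + x - 3 := by
        have h4 : x ^ 4 = x ^ 2 + x := by
          calc x ^ 4 = x * x ^ 3 := by ring
            _ = _ := by rw [hx]; ring
        rw [h4, hx]
        linear_combination (3 * x - 3) * hx
      linarith
    | succ n ih =>
      have h := hrec n
      have e : E (n + 1 + 1) ^ 2 + x * E (n + 1) * E (n + 1 + 1) + (x ^ 2 - 1) * E (n + 1) ^ 2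
          = (x ^ 2 - 1) * (E (n + 1) ^ 2 + x * E n * E (n + 1) + (x ^ 2 - 1) * E n ^ 2) := by
        rw [h]; ring
      rw [e]
      nlinarith
  have h := hQ n
  have h9 : E n ^ 2 ≤ 3 ^ 2 := by
    have : (E (n + 1) + x / 2 * E n) ^ 2 + (3 / 4 * x ^ 2 - 1) * E n ^ 2 ≤ 2 := by
      linarith [h, show (E (n + 1) + x / 2 * E n) ^ 2 + (3 / 4 * x ^ 2 - 1) * E n ^ 2 =
        E (n + 1) ^ 2 + x * E n * E (n + 1) + (x ^ 2 - 1) * E n ^ 2 by ring]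
    nlinarith [sq_nonneg (E (n + 1) + x / 2 * E n), sq_nonneg (E n)]
  exact abs_le_of_sq_le_sq h9 (by norm_num)

theorem exists_root : ∃ x : ℝ, x ^ 3 = x + 1 ∧ 1.32 < x ∧ x < 1.33 := by
  have hc : ContinuousOn (fun x : ℝ => x ^ 3 - x) (Set.Icc 1.32 1.33) := by fun_prop
  have h := intermediate_value_Ioo (by norm_num : (1.32 : ℝ) ≤ 1.33) hc
  obtain ⟨x, hx, hx1⟩ := h (show (1 : ℝ) ∈ _ by constructor <;> norm_num)
  exact ⟨x, by simp only at hx1; linarith, hx.1, hx.2⟩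

/-- The basic approximation. -/
theorem approx (x : ℝ) (hx : x ^ 3 = x + 1) (hx1 : 1.32 < x) (hx2 : x < 1.33)
    (n d₁ d₂ ℓ₁ ℓ₂ : ℕ) (hd₁ : d₁ ≤ 9) (hd₂ : d₂ ≤ 9) (hd₁pos : 0 < d₁)
    (heq : (9 : ℤ) * (padovan n : ℤ) = (d₁ : ℤ) * 10 ^ (ℓ₁ + ℓ₂)
      - ((d₁ : ℤ) - (d₂ : ℤ)) * 10 ^ ℓ₂ - (d₂ : ℤ)) (hℓ₂ : 1 ≤ ℓ₂) :
    ∃ ρ : ℝ, x ^ (n + 3) = ((d₁ : ℝ) * (3 * x ^ 2 - 1) / 9) * 10 ^ (ℓ₁ + ℓ₂) * ρ ∧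
      |ρ - 1| * 10 ^ ℓ₁ ≤ 11 := by
  have hR : (9 : ℝ) * (padovan n : ℝ) = (d₁ : ℝ) * 10 ^ (ℓ₁ + ℓ₂)
      - ((d₁ : ℝ) - (d₂ : ℝ)) * 10 ^ ℓ₂ - (d₂ : ℝ) := by exact_mod_cast heq
  have hE := padovan_err x hx hx1 hx2 n
  have hx2' : 1.7424 < x ^ 2 := by nlinarith
  have hx2'' : x ^ 2 < 1.7689 := by nlinarith
  obtain ⟨D, hD⟩ : ∃ D, D = 3 * x ^ 2 - 1 := ⟨_, rfl⟩
  have hD1 : 4.2272 < D := by rw [hD]; linarith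
  have hD2 : D < 4.3067 := by rw [hD]; linarith
  rw [← hD] at hE ⊢
  have a1 : (1 : ℝ) ≤ d₁ := by exact_mod_cast hd₁pos
  have a2 : (d₁ : ℝ) ≤ 9 := by exact_mod_cast hd₁
  have a3 : (0 : ℝ) ≤ d₂ := Nat.cast_nonneg _
  have a4 : (d₂ : ℝ) ≤ 9 := by exact_mod_cast hd₂
  have hu : (10 : ℝ) ≤ 10 ^ ℓ₂ := by
    calc (10 : ℝ) = 10 ^ 1 := by norm_num
      _ ≤ _ := pow_le_pow_right₀ (by norm_num) hℓ₂
  obtain ⟨u, hu'⟩ : ∃ u : ℝ, u = 10 ^ ℓ₂ := ⟨_, rfl⟩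
  obtain ⟨w, hw'⟩ : ∃ w : ℝ, w = 10 ^ ℓ₁ := ⟨_, rfl⟩
  have hw0 : 0 < w := by rw [hw']; positivity
  have hwu : (10 : ℝ) ^ (ℓ₁ + ℓ₂) = w * u := by rw [hu', hw', pow_add]
  rw [hwu, ← hu'] at hR
  rw [hwu, ← hw']
  rw [← hu'] at hu
  set y := x ^ (n + 3) with hy
  have hθ : 0 < (d₁ : ℝ) * D / 9 * (w * u) := by positivity
  refine ⟨y / ((d₁ : ℝ) * D / 9 * (w * u)), by field_simp, ?_⟩
  have hz : |((d₁ : ℝ) - d₂) * u + d₂| ≤ 9.9 * u := by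
    rw [abs_le]; constructor <;> nlinarith
  have hmain : |y - (d₁ : ℝ) * D / 9 * (w * u)| ≤ 46 / 9 * u := by
    have e : y - (d₁ : ℝ) * D / 9 * (w * u) =
        -(D / 9 * (((d₁ : ℝ) - d₂) * u + d₂)) - (D * padovan n - y) := by
      linear_combination (D / 9) * hR
    rw [e]
    calc _ ≤ |-(D / 9 * (((d₁ : ℝ) - d₂) * u + d₂))| + |D * padovan n - y| := abs_sub _ _
      _ = D / 9 * |((d₁ : ℝ) - d₂) * u + d₂| + |D * padovan n - y| := by
        rw [abs_neg, abs_mul, abs_of_pos (by positivity : 0 < D / 9)]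
      _ ≤ 4.3067 / 9 * (9.9 * u) + 3 := by gcongr
      _ ≤ _ := by linarith
  have e2 : |y / ((d₁ : ℝ) * D / 9 * (w * u)) - 1| =
      |y - (d₁ : ℝ) * D / 9 * (w * u)| / ((d₁ : ℝ) * D / 9 * (w * u)) := by
    rw [← abs_of_pos hθ, ← abs_div, abs_of_pos hθ]
    congr 1
    field_simp
  rw [e2, div_mul_eq_mul_div, div_le_iff₀ hθ]
  calc _ ≤ 46 / 9 * u * w := by gcongr
    _ ≤ 11 * (1 * 4.2272 / 9 * (w * u)) := by
      have : 0 < u * w := by positivity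
      nlinarith
    _ ≤ _ := by gcongr


/-! ### Part 6: conclusion -/

theorem ell2_bound (n d₁ d₂ ℓ₁ ℓ₂ : ℕ) (hn : 1 ≤ n) (hd₁ : d₁ ≤ 9) (hd₂ : d₂ ≤ 9)
    (hne : d₁ ≠ d₂) (hd₁pos : 0 < d₁)
    (heq : (9 : ℤ) * (padovan n : ℤ) = (d₁ : ℤ) * 10 ^ (ℓ₁ + ℓ₂)
      - ((d₁ : ℤ) - (d₂ : ℤ)) * 10 ^ ℓ₂ - (d₂ : ℤ)) : ℓ₂ ≤ 3 ∨ 2 ^ ℓ₂ ≤ n + 16 := by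
  rcases Nat.eq_zero_or_pos d₂ with h0 | hpos
  · right
    apply two_adic n ℓ₂ hn
    subst h0
    have h1 : (9 : ℤ) * padovan n = 2 ^ ℓ₂ * (5 ^ ℓ₂ * (d₁ * 10 ^ ℓ₁ - d₁)) := by
      rw [heq, pow_add, show (10 : ℤ) ^ ℓ₂ = 2 ^ ℓ₂ * 5 ^ ℓ₂ by rw [← mul_pow]; norm_num]
      push_cast
      ring
    have h2 : (2 : ℤ) ^ ℓ₂ ∣ 9 * padovan n := ⟨_, h1⟩
    have h3 : 2 ^ ℓ₂ ∣ 9 * padovan n := by exact_mod_cast h2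
    exact (Nat.Coprime.pow_left ℓ₂ (by norm_num : Nat.Coprime 2 9)).dvd_of_dvd_mul_left h3
  · left
    by_contra hc
    refine sieve_main n d₁ d₂ (ℓ₁ + ℓ₂) ℓ₂ hd₁ hd₂ hne hd₁pos hpos (by omega) (by omega) ?_
    have : (9 : ℤ) * padovan n + d₂ + d₁ * 10 ^ ℓ₂ = d₁ * 10 ^ (ℓ₁ + ℓ₂) + d₂ * 10 ^ ℓ₂ := by
      linarith
    exact_mod_cast this

theorem n_le (x : ℝ) (hx1 : 1.32 < x) (hx2 : x < 1.33) (d m L l : ℕ) (hd : d ≤ 9)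
    (hl : 1 ≤ l) (ρ : ℝ) (h : x ^ m = ((d : ℝ) * (3 * x ^ 2 - 1) / 9) * 10 ^ L * ρ)
    (hρ : |ρ - 1| * 10 ^ l ≤ 11) : m ≤ 9 * L + 17 := by
  have hp : (10 : ℝ) ≤ 10 ^ l := by
    calc (10 : ℝ) = 10 ^ 1 := by norm_num
      _ ≤ _ := pow_le_pow_right₀ (by norm_num) hl
  have hρ1 : |ρ - 1| ≤ 1.1 := by nlinarith [abs_nonneg (ρ - 1)]
  have hρ2 : ρ ≤ 2.1 := by linarith [le_abs_self (ρ - 1)]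
  have hd' : (d : ℝ) ≤ 9 := by exact_mod_cast hd
  have hx2' : 1.7424 < x ^ 2 := by nlinarith
  have hx2'' : x ^ 2 < 1.7689 := by nlinarith
  have hθ : (d : ℝ) * (3 * x ^ 2 - 1) / 9 ≤ 4.3067 := by
    have : (0 : ℝ) ≤ d := Nat.cast_nonneg _
    nlinarith
  have hθ0 : 0 ≤ (d : ℝ) * (3 * x ^ 2 - 1) / 9 := by
    have : 0 ≤ 3 * x ^ 2 - 1 := by linarith
    positivity
  have h10 : (0 : ℝ) < 10 ^ L := by positivity
  have h1 : x ^ m ≤ 10 ^ (L + 1) := by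
    rw [h, pow_succ (10 : ℝ) L]
    calc (d : ℝ) * (3 * x ^ 2 - 1) / 9 * 10 ^ L * ρ ≤ (d : ℝ) * (3 * x ^ 2 - 1) / 9 * 10 ^ L * 2.1 := by
          gcongr
      _ ≤ 4.3067 * 10 ^ L * 2.1 := by gcongr
      _ ≤ _ := by linarith
  have h9 : (10 : ℝ) ≤ x ^ 9 := by
    calc (10 : ℝ) ≤ 1.32 ^ 9 := by norm_num
      _ ≤ _ := by gcongr
  have h2 : (10 : ℝ) ^ (m / 9) ≤ 10 ^ (L + 1) := by
    calc (10 : ℝ) ^ (m / 9) ≤ (x ^ 9) ^ (m / 9) := by gcongr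
      _ = x ^ (9 * (m / 9)) := by rw [← pow_mul]
      _ ≤ x ^ m := pow_le_pow_right₀ (by linarith) (by omega)
      _ ≤ _ := h1
  have h3 : m / 9 ≤ L + 1 := (pow_le_pow_iff_right₀ (by norm_num)).1 h2
  omega

theorem pow_ge (k : ℕ) (hk : 12 ≤ k) : 9 * k + 1100 < 2 ^ k := by
  induction k, hk using Nat.le_induction with
  | base => norm_num
  | succ k hk ih => rw [pow_succ]; omega

theorem one_add_pow_le (η : ℝ) (k : ℕ) (h0 : 0 ≤ η) (h1 : η ≤ 1 / 2) (h : (k : ℝ) * η ≤ 1 / 1000) :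
    (1 + η) ^ k ≤ 1.01 ∧ 0.99 ≤ (1 - η) ^ k := by
  have h2 : 1 + (k : ℝ) * (-η) ≤ (1 + -η) ^ k := one_add_mul_le_pow (by linarith) k
  have h3 : 0.99 ≤ (1 - η) ^ k := by rw [sub_eq_add_neg]; linarith
  refine ⟨?_, h3⟩
  have h4 : (1 + η) ^ k * (1 - η) ^ k ≤ 1 := by
    rw [← mul_pow]
    exact pow_le_one₀ (by nlinarith) (by nlinarith)
  have h5 : (0 : ℝ) ≤ (1 + η) ^ k := by positivity
  have h6 : 0.999 ≤ (1 - η) ^ k := by rw [sub_eq_add_neg]; linarith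
  nlinarith

/-- Transcendence step: `m` is at most `2 ^ 300`. -/
theorem m_bound (x : ℝ) (hx : x ^ 3 = x + 1) (hx1 : 1.32 < x) (hx2 : x < 1.33)
    (d m l₁ l₂ : ℕ) (hd0 : 0 < d) (hd : d ≤ 9) (hl : 2 ≤ l₁) (ρ : ℝ)
    (h : x ^ m = ((d : ℝ) * (3 * x ^ 2 - 1) / 9) * 10 ^ (l₁ + l₂) * ρ)
    (hρ : |ρ - 1| * 10 ^ l₁ ≤ 11) (hl₂ : l₂ ≤ 3 ∨ 2 ^ l₂ ≤ m + 16) : m + 1 ≤ 2 ^ 300 := by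
  have hmL := n_le x hx1 hx2 d m (l₁ + l₂) l₁ hd (by omega) ρ h hρ
  have hp : (100 : ℝ) ≤ 10 ^ l₁ := by
    calc (100 : ℝ) = 10 ^ 2 := by norm_num
      _ ≤ _ := pow_le_pow_right₀ (by norm_num) hl
  have hρ1 : |ρ - 1| ≤ 0.11 := by nlinarith [abs_nonneg (ρ - 1)]
  have hρ3 : 0.89 ≤ ρ := by linarith [neg_abs_le (ρ - 1)]
  have hd' : (1 : ℝ) ≤ d := by exact_mod_cast hd0
  have hx2' : 1.7424 < x ^ 2 := by nlinarith
  obtain ⟨hθ0, -⟩ := log_theta x (by linarith) hx2 d hd0 hd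
  have hθ1 : 0.46 ≤ (d : ℝ) * (3 * x ^ 2 - 1) / 9 := by nlinarith
  have hLm : l₁ + l₂ ≤ m := by
    by_contra hc
    push Not at hc
    have h1 : (10 : ℝ) ^ (m + 1) ≤ 10 ^ (l₁ + l₂) := pow_le_pow_right₀ (by norm_num) hc
    have h2 : x ^ m ≤ 10 ^ m := by gcongr; linarith
    have h3 : 0.46 * 10 ^ (m + 1) * 0.89 ≤ x ^ m := by
      rw [h]; gcongr
    rw [pow_succ] at h3
    have : (0 : ℝ) < 10 ^ m := by positivity
    linarith
  obtain ⟨T, hT⟩ : ∃ T : ℕ, T = 300 := ⟨_, rfl⟩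
  rw [← hT]
  by_contra hcon
  push Not at hcon
  obtain ⟨b, hb⟩ : ∃ b, b = Nat.log 2 (m + 1) + 1 := ⟨_, rfl⟩
  have hb1 : m + 1 < 2 ^ b := by
    rw [hb]; exact Nat.lt_pow_succ_log_self (by norm_num) _
  have hb2 : 2 ^ b ≤ 2 * (m + 1) := by
    rw [hb, pow_succ, mul_comm]
    exact Nat.mul_le_mul_left 2 (Nat.pow_log_le_self 2 (by omega))
  have hb300 : 300 ≤ b := by
    have : 2 ^ T < 2 ^ b := hcon.trans hb1
    rw [← hT]
    exact ((Nat.pow_lt_pow_iff_right (by norm_num)).1 this).le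
  obtain ⟨R, hR⟩ : ∃ R, R = 2 ^ 22 * b ^ 4 := ⟨_, rfl⟩
  have hbk := baker_main x hx (by linarith) hx2 d hd0 hd m (l₁ + l₂) b R hb300 hR hb1.le
    (by omega) _ rfl
  have hlog : (m : ℝ) * Real.log x - ((l₁ + l₂ : ℕ) : ℝ) * Real.log 10
      - Real.log ((d : ℝ) * (3 * x ^ 2 - 1) / 9) = Real.log ρ := by
    have := congrArg Real.log h
    rw [Real.log_mul (by positivity) (by positivity), Real.log_mul (by positivity) (by positivity),
      Real.log_pow, Real.log_pow] at this
    linarith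
  rw [hlog] at hbk
  have hlr : |Real.log ρ| ≤ 2 * |ρ - 1| := by
    have h1 : Real.log ρ ≤ ρ - 1 := Real.log_le_sub_one_of_pos (by linarith)
    have h2 : 1 - ρ⁻¹ ≤ Real.log ρ := Real.one_sub_inv_le_log_of_pos (by linarith)
    have h3 : - (2 * |ρ - 1|) ≤ 1 - ρ⁻¹ := by
      have e : 1 - ρ⁻¹ = (ρ - 1) / ρ := by
        have : ρ ≠ 0 := by positivity
        field_simp
      rw [e, le_div_iff₀ (by linarith)]
      nlinarith [neg_abs_le (ρ - 1), abs_nonneg (ρ - 1)]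
    rw [abs_le]
    constructor
    · linarith
    · linarith [le_abs_self (ρ - 1), abs_nonneg (ρ - 1)]
  have hl1 : l₁ < 5 + 200 * b * R ^ 4 := by
    have h1 : (10 : ℝ) ^ l₁ < 22 * 2 ^ (200 * b * R ^ 4) := by
      have hp0 : (0 : ℝ) < 10 ^ l₁ := by positivity
      have ht0 : (0 : ℝ) < 2 ^ (200 * b * R ^ 4) := by positivity
      calc (10 : ℝ) ^ l₁ = 1 * 10 ^ l₁ := by ring
        _ < (|Real.log ρ| * 2 ^ (200 * b * R ^ 4)) * 10 ^ l₁ := by gcongr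
        _ ≤ ((2 * |ρ - 1|) * 2 ^ (200 * b * R ^ 4)) * 10 ^ l₁ := by gcongr
        _ = 2 * (|ρ - 1| * 10 ^ l₁) * 2 ^ (200 * b * R ^ 4) := by ring
        _ ≤ 2 * 11 * 2 ^ (200 * b * R ^ 4) := by gcongr
        _ = _ := by norm_num
    have h2 : (2 : ℝ) ^ l₁ < 2 ^ (5 + 200 * b * R ^ 4) := by
      calc (2 : ℝ) ^ l₁ ≤ 10 ^ l₁ := by gcongr; norm_num
        _ < 22 * 2 ^ (200 * b * R ^ 4) := h1
        _ ≤ 2 ^ 5 * 2 ^ (200 * b * R ^ 4) := by gcongr; norm_num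
        _ = _ := by rw [← pow_add]
    exact (pow_lt_pow_iff_right₀ (by norm_num)).1 h2
  have hl2 : l₂ ≤ b + 1 := by
    rcases hl₂ with h3 | h3
    · omega
    · have h4 : 16 ≤ 2 ^ b := by
        calc 16 = 2 ^ 4 := by norm_num
          _ ≤ 2 ^ b := Nat.pow_le_pow_right (by norm_num) (by omega)
      have : 2 ^ l₂ < 2 ^ (b + 1) := by rw [pow_succ]; omega
      exact ((Nat.pow_lt_pow_iff_right (by norm_num)).1 this).le
  have hg := pow_growth b hb300
  have hbR : b * R ^ 4 = 2 ^ 88 * b ^ 17 := by rw [hR]; ring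
  have e1 : 200 * b * R ^ 4 = 200 * 2 ^ 88 * b ^ 17 := by rw [mul_assoc, hbR]; ring
  rw [e1] at hl1
  have hb17 : b ≤ b ^ 17 := Nat.le_self_pow (by norm_num) b
  omega

/-- Reduction step: `l₁` is at most 110. -/
theorem l1_bound (x : ℝ) (hx : x ^ 3 = x + 1) (hx1 : 1.32 < x)
    (d m l₁ L : ℕ) (hd0 : 0 < d) (hd : d ≤ 9) (ρ : ℝ)
    (h : x ^ m = ((d : ℝ) * (3 * x ^ 2 - 1) / 9) * 10 ^ L * ρ)
    (hρ : |ρ - 1| * 10 ^ l₁ ≤ 11) (hm : m + 1 ≤ 2 ^ 300) : l₁ ≤ 110 := by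
  by_contra hc
  push Not at hc
  obtain ⟨q, p, hq, hp1, hp2, hy⟩ := red_data x hx (by linarith)
  obtain ⟨e, he1, he2⟩ := hy d hd0 hd
  have hD : 0 ≤ 3 * x ^ 2 - 1 := by clear * - hx1; nlinarith
  obtain ⟨θ, hθ⟩ : ∃ θ, θ = (d : ℝ) * (3 * x ^ 2 - 1) / 9 := ⟨_, rfl⟩
  have hθ0 : 0 ≤ θ := by rw [hθ]; positivity
  rw [← hθ] at h he1 he2
  have hρ1 : |ρ - 1| ≤ 11 / 10 ^ 111 := by
    rw [le_div_iff₀ (by positivity)]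
    refine le_trans ?_ hρ
    gcongr
    · norm_num
    · exact hc
  have hmR : (m : ℝ) ≤ 10 ^ 91 := by
    have h1 : m ≤ 10 ^ 91 := by
      calc m ≤ 2 ^ 300 := by omega
        _ = (2 ^ 100) ^ 3 := by rw [← pow_mul]
        _ ≤ (2 * 10 ^ 30) ^ 3 := by gcongr; norm_num
        _ ≤ 10 ^ 91 := by norm_num
    exact_mod_cast h1
  obtain ⟨f1, -⟩ := one_add_pow_le (1 / 10 ^ 96) m (by positivity) (by norm_num) (by
    calc (m : ℝ) * (1 / 10 ^ 96) ≤ 10 ^ 91 * (1 / 10 ^ 96) := by gcongr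
      _ ≤ _ := by norm_num)
  obtain ⟨g1, g2⟩ := one_add_pow_le (11 / 10 ^ 111) q (by positivity) (by norm_num) (by
    calc (q : ℝ) * (11 / 10 ^ 111) ≤ 10 ^ 97 * (11 / 10 ^ 111) := by gcongr
      _ ≤ _ := by norm_num)
  obtain ⟨i1, i2⟩ := abs_le.1 hρ1
  have hη : (11 : ℝ) / 10 ^ 111 < 1 / 2 := by norm_num
  have k1 : ρ ^ q ≤ 1.01 := by
    refine le_trans (pow_le_pow_left₀ (by linarith) ?_ q) g1
    linarith
  have k2 : 0.99 ≤ ρ ^ q := by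
    refine g2.trans (pow_le_pow_left₀ (by linarith) ?_ q)
    linarith
  have hkey : (x ^ q) ^ m * 10 ^ q = (10 * θ) ^ q * ρ ^ q * 10 ^ (L * q) := by
    rw [← pow_mul, mul_comm q m, pow_mul x m q, h, mul_pow, mul_pow, mul_pow, ← pow_mul]
    ring
  have u1 : (10 : ℝ) ^ (p * m + q) ≤ (x ^ q) ^ m * 10 ^ q := by
    rw [pow_add, pow_mul]
    gcongr
  have u2 : (x ^ q) ^ m * 10 ^ q ≤ 1.01 * 10 ^ (p * m + q) := by
    calc (x ^ q) ^ m * 10 ^ q ≤ (10 ^ p * (1 + 1 / 10 ^ 96)) ^ m * 10 ^ q := by gcongr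
      _ = (1 + 1 / 10 ^ 96) ^ m * 10 ^ (p * m + q) := by rw [mul_pow, pow_add, pow_mul]; ring
      _ ≤ _ := by gcongr
  have v1 : 1.08 * 10 ^ (e + L * q) ≤ (10 * θ) ^ q * ρ ^ q * 10 ^ (L * q) := by
    calc (1.08 : ℝ) * 10 ^ (e + L * q) ≤ (1.1 * 10 ^ e) * 0.99 * 10 ^ (L * q) := by
          rw [pow_add]
          have : (0 : ℝ) < 10 ^ e * 10 ^ (L * q) := by positivity
          linarith
      _ ≤ _ := by gcongr
  have v2 : (10 * θ) ^ q * ρ ^ q * 10 ^ (L * q) ≤ 9.1 * 10 ^ (e + L * q) := by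
    calc (10 * θ) ^ q * ρ ^ q * 10 ^ (L * q) ≤ (9 * 10 ^ e) * 1.01 * 10 ^ (L * q) := by gcongr
      _ ≤ _ := by
        rw [pow_add]
        have : (0 : ℝ) < 10 ^ e * 10 ^ (L * q) := by positivity
        linarith
  rw [← hkey] at v1 v2
  generalize p * m + q = a at u1 u2
  generalize e + L * q = c at v1 v2
  generalize (x ^ q) ^ m * 10 ^ q = z at *
  have hc0 : (0 : ℝ) < 10 ^ c := by positivity
  rcases Nat.lt_or_ge c a with hac | hac
  · have : (10 : ℝ) ^ (c + 1) ≤ 10 ^ a := pow_le_pow_right₀ (by norm_num) hac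
    rw [pow_succ] at this
    linarith
  · have : (10 : ℝ) ^ a ≤ 10 ^ c := pow_le_pow_right₀ (by norm_num) hac
    linarith


/-- If `P n = (1/9)(d₁·10^(ℓ₁+ℓ₂) − (d₁−d₂)·10^ℓ₂ − d₂)` with `n ≥ 1`, distinct digits
`d₁ ≠ d₂`, `d₁ > 0`, and `ℓ₁, ℓ₂ ≥ 1`, then `ℓ₁ + ℓ₂ < 9.15×10⁴⁷` and `n < 7.38×10⁴⁸`. -/
theorem padovan_concat_initial_bound
    (n d₁ d₂ ℓ₁ ℓ₂ : ℕ) (hn : 1 ≤ n)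
    (hd₁ : d₁ ≤ 9) (hd₂ : d₂ ≤ 9) (hne : d₁ ≠ d₂) (hd₁pos : 0 < d₁)
    (hℓ₁ : 1 ≤ ℓ₁) (hℓ₂ : 1 ≤ ℓ₂)
    (heq : (9 : ℤ) * (padovan n : ℤ) =
      (d₁ : ℤ) * 10 ^ (ℓ₁ + ℓ₂) - ((d₁ : ℤ) - (d₂ : ℤ)) * 10 ^ ℓ₂ - (d₂ : ℤ)) :
    ((ℓ₁ : ℝ) + (ℓ₂ : ℝ) < 9.15e47) ∧ ((n : ℝ) < 7.38e48) := by
  obtain ⟨x, hx, hx1, hx2⟩ := exists_root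
  obtain ⟨ρ, h, hρ⟩ := approx x hx hx1 hx2 n d₁ d₂ ℓ₁ ℓ₂ hd₁ hd₂ hd₁pos heq hℓ₂
  have hl2 := ell2_bound n d₁ d₂ ℓ₁ ℓ₂ hn hd₁ hd₂ hne hd₁pos heq
  have hl1 : ℓ₁ ≤ 110 := by
    rcases Nat.lt_or_ge ℓ₁ 2 with h2 | h2
    · omega
    · refine l1_bound x hx hx1 d₁ (n + 3) ℓ₁ (ℓ₁ + ℓ₂) hd₁pos hd₁ ρ h hρ ?_
      refine m_bound x hx hx1 hx2 d₁ (n + 3) ℓ₁ ℓ₂ hd₁pos hd₁ h2 ρ h hρ ?_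
      exact hl2.imp_right fun h => by omega
  have hnL := n_le x hx1 hx2 d₁ (n + 3) (ℓ₁ + ℓ₂) ℓ₁ hd₁ hℓ₁ ρ h hρ
  have hl2' : ℓ₂ ≤ 11 := by
    rcases hl2 with h3 | h3
    · omega
    · by_contra hc
      have := pow_ge ℓ₂ (by omega)
      omega
  have hL : ((ℓ₁ + ℓ₂ : ℕ) : ℝ) ≤ (1000 : ℕ) := Nat.cast_le.2 (by omega)
  have hN : (n : ℝ) ≤ (10000 : ℕ) := Nat.cast_le.2 (by omega)
  push_cast at hL hN
  constructor
  · exact lt_of_le_of_lt hL (by norm_num)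
  · exact lt_of_le_of_lt hN (by norm_num)
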